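/- Let G be a connected affine algebraic group over ℂ with covering q_G : G̃ = G_u ⋊ (Z × G̃'_red) → G and kernel Π_G, and let A_s be a torus. A homomorphism of algebraic groups γ : Π_G → A_s extends to a morphism of algebraic groups G̃ → A_s if and only if γ vanishes on the subgroup π₁(G'_red) ⊆ Π_G. Hence the image of the restriction map Hom(G̃, A_s) → Hom(Π_G, A_s) equals the annihilator of π₁(G'_red). -/

import Mathlib

noncomputable section

open MvPolynomial

/-- Points of affine `n`-space over `ℂ`. -/
abbrev Pt (n : ℕ) : Type := Fin n → ℂ

/-- A subset of `ℂ^n` is an (affine) algebraic set if it is the common zero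
locus of a set of polynomials. -/
def IsAlgebraicSet {n : ℕ} (V : Set (Pt n)) : Prop :=
  ∃ S : Set (MvPolynomial (Fin n) ℂ), V = {x : Pt n | ∀ p ∈ S, eval x p = 0}

/-- A map `ℂ^n → ℂ^m` is regular (polynomial) on a subset `V ⊆ ℂ^n`. -/
def IsRegularOn {n m : ℕ} (V : Set (Pt n)) (f : Pt n → Pt m) : Prop :=
  ∃ P : Fin m → MvPolynomial (Fin n) ℂ, ∀ x ∈ V, ∀ i, f x i = eval x (P i)

def Pt.left {n m : ℕ} (z : Pt (n + m)) : Pt n := fun i => z (Fin.castAdd m i)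
def Pt.right {n m : ℕ} (z : Pt (n + m)) : Pt m := fun i => z (Fin.natAdd n i)

/-- An affine algebraic group over `ℂ`, realized as an algebraic subset of some
`ℂ^n`, with polynomial multiplication and inversion. -/
structure AffAlgGroup : Type where
  n : ℕ
  carrier : Set (Pt n)
  isAlgebraic : IsAlgebraicSet carrier
  one : Pt n
  one_mem : one ∈ carrier
  mul : Pt n → Pt n → Pt n
  inv : Pt n → Pt n
  mul_mem : ∀ {x y : Pt n}, x ∈ carrier → y ∈ carrier → mul x y ∈ carrier
  inv_mem : ∀ {x : Pt n}, x ∈ carrier → inv x ∈ carrier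
  mul_assoc' : ∀ {x y z : Pt n}, x ∈ carrier → y ∈ carrier → z ∈ carrier →
    mul (mul x y) z = mul x (mul y z)
  one_mul' : ∀ {x : Pt n}, x ∈ carrier → mul one x = x
  mul_one' : ∀ {x : Pt n}, x ∈ carrier → mul x one = x
  inv_mul' : ∀ {x : Pt n}, x ∈ carrier → mul (inv x) x = one
  mul_regular : IsRegularOn
    {z : Pt (n + n) | Pt.left z ∈ carrier ∧ Pt.right z ∈ carrier}
    (fun z => mul (Pt.left z) (Pt.right z))
  inv_regular : IsRegularOn carrier inv

namespace AffAlgGroup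

/-- The group of `ℂ`-points of `G`, as a bundled group. -/
def Gp (G : AffAlgGroup) : Type := {x : Pt G.n // x ∈ G.carrier}

instance (G : AffAlgGroup) : Group G.Gp where
  mul x y := ⟨G.mul x.1 y.1, G.mul_mem x.2 y.2⟩
  one := ⟨G.one, G.one_mem⟩
  inv x := ⟨G.inv x.1, G.inv_mem x.2⟩
  mul_assoc a b c := Subtype.ext (G.mul_assoc' a.2 b.2 c.2)
  one_mul a := Subtype.ext (G.one_mul' a.2)
  mul_one a := Subtype.ext (G.mul_one' a.2)
  inv_mul_cancel a := Subtype.ext (G.inv_mul' a.2)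

/-- The Euclidean (classical) topology on the points of `G`. -/
instance (G : AffAlgGroup) : TopologicalSpace G.Gp :=
  instTopologicalSpaceSubtype

/-- Connectedness of an affine algebraic group: the carrier cannot be divided
into two disjoint relatively (Zariski-)closed pieces. -/
def IsConnected (G : AffAlgGroup) : Prop :=
  ∀ V W : Set (Pt G.n), IsAlgebraicSet V → IsAlgebraicSet W →
    G.carrier ⊆ V ∪ W → G.carrier ∩ (V ∩ W) = ∅ →
    G.carrier ⊆ V ∨ G.carrier ⊆ W

def IsAbelianGrp (G : AffAlgGroup) : Prop :=
  ∀ x ∈ G.carrier, ∀ y ∈ G.carrier, G.mul x y = G.mul y x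

/-- `G` is a torus: it is isomorphic, as an algebraic group, to `(ℂ*)^k`;
the isomorphism and its inverse are required to be given by (Laurent)
polynomials. -/
def IsTorus (G : AffAlgGroup) : Prop :=
  ∃ (k : ℕ) (φ : (Fin k → ℂˣ) → Pt G.n),
    (∀ u, φ u ∈ G.carrier) ∧
    Function.Injective φ ∧
    (∀ x ∈ G.carrier, ∃ u, φ u = x) ∧
    φ (fun _ => 1) = G.one ∧
    (∀ u v, φ (u * v) = G.mul (φ u) (φ v)) ∧
    (∀ i : Fin G.n, ∃ P : MvPolynomial (Fin k ⊕ Fin k) ℂ,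
      ∀ u, φ u i = eval (Sum.elim (fun j => (u j : ℂ)) (fun j => ((u j)⁻¹ : ℂˣ))) P) ∧
    (∀ j : Fin k, ∃ Q : MvPolynomial (Fin G.n) ℂ, ∀ u, (u j : ℂ) = eval (φ u) Q)

end AffAlgGroup

/-- matrix entry access for a point of `ℂ^{m·m}` viewed as an `m × m` matrix -/
def matEntry {m : ℕ} (x : Pt (m * m)) (i j : Fin m) : ℂ := x (finProdFinEquiv (i, j))

/-- matrix multiplication on points of `ℂ^{m·m}` -/
def matMulPt (m : ℕ) (x y : Pt (m * m)) : Pt (m * m) :=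
  fun idx => ∑ k : Fin m,
    matEntry x (finProdFinEquiv.symm idx).1 k * matEntry y k (finProdFinEquiv.symm idx).2

/-- the identity matrix as a point of `ℂ^{m·m}` -/
def idMatPt (m : ℕ) : Pt (m * m) :=
  fun idx => if (finProdFinEquiv.symm idx).1 = (finProdFinEquiv.symm idx).2 then 1 else 0

/-- an upper triangular matrix with `1`'s on the diagonal -/
def IsUnitriangular (m : ℕ) (x : Pt (m * m)) : Prop :=
  (∀ i : Fin m, matEntry x i i = 1) ∧ (∀ i j : Fin m, j < i → matEntry x i j = 0)

/-- `G` is unipotent: it admits a faithful polynomial representation by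
upper triangular unipotent matrices. -/
def AffAlgGroup.IsUnipotent (G : AffAlgGroup) : Prop :=
  ∃ (m : ℕ) (φ : Pt G.n → Pt (m * m)),
    IsRegularOn G.carrier φ ∧
    Set.InjOn φ G.carrier ∧
    (∀ x ∈ G.carrier, IsUnitriangular m (φ x)) ∧
    (∀ x ∈ G.carrier, ∀ y ∈ G.carrier, φ (G.mul x y) = matMulPt m (φ x) (φ y))

/-- A homomorphism of affine algebraic groups: a polynomial map which is
multiplicative on points. -/
structure AlgGroupHom (G H : AffAlgGroup) : Type where
  toFun : Pt G.n → Pt H.n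
  maps_to : ∀ {x : Pt G.n}, x ∈ G.carrier → toFun x ∈ H.carrier
  map_mul : ∀ {x y : Pt G.n}, x ∈ G.carrier → y ∈ G.carrier →
    toFun (G.mul x y) = H.mul (toFun x) (toFun y)
  regular : IsRegularOn G.carrier toFun

/-- An algebraic action of `G` on `A` by group automorphisms. -/
structure AlgAction (G A : AffAlgGroup) : Type where
  act : Pt G.n → Pt A.n → Pt A.n
  maps_to : ∀ {g : Pt G.n} {a : Pt A.n}, g ∈ G.carrier → a ∈ A.carrier →
    act g a ∈ A.carrier
  act_one : ∀ {a : Pt A.n}, a ∈ A.carrier → act G.one a = a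
  act_mul : ∀ {g h : Pt G.n} {a : Pt A.n}, g ∈ G.carrier → h ∈ G.carrier →
    a ∈ A.carrier → act (G.mul g h) a = act g (act h a)
  act_map_mul : ∀ {g : Pt G.n} {a b : Pt A.n}, g ∈ G.carrier → a ∈ A.carrier →
    b ∈ A.carrier → act g (A.mul a b) = A.mul (act g a) (act g b)
  act_bij : ∀ {g : Pt G.n}, g ∈ G.carrier → ∀ a ∈ A.carrier, ∃ b ∈ A.carrier, act g b = a
  regular : IsRegularOn
    {z : Pt (G.n + A.n) | Pt.left z ∈ G.carrier ∧ Pt.right z ∈ A.carrier}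
    (fun z => act (Pt.left z) (Pt.right z))

/-- the trivial action of `G` on `A` -/
def AlgAction.IsTrivial {G A : AffAlgGroup} (ρ : AlgAction G A) : Prop :=
  ∀ g ∈ G.carrier, ∀ a ∈ A.carrier, ρ.act g a = a

/-- An extension `1 → A → E → G → 1` of affine algebraic groups inducing
(via conjugation in `E`) the action `ρ` of `G` on `A`. -/
structure AlgExtension (G A : AffAlgGroup) (ρ : AlgAction G A) : Type where
  E : AffAlgGroup
  i : AlgGroupHom A E
  q : AlgGroupHom E G
  i_inj : Set.InjOn i.toFun A.carrier
  q_surj : ∀ g ∈ G.carrier, ∃ x ∈ E.carrier, q.toFun x = g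
  exact : ∀ x ∈ E.carrier, (q.toFun x = G.one ↔ ∃ a ∈ A.carrier, i.toFun a = x)
  conj_compat : ∀ x ∈ E.carrier, ∀ a ∈ A.carrier,
    E.mul x (E.mul (i.toFun a) (E.inv x)) = i.toFun (ρ.act (q.toFun x) a)

namespace AlgExtension

variable {G A : AffAlgGroup} {ρ : AlgAction G A}

/-- An extension splits if the quotient map admits an algebraic group
theoretic section. -/
def Splits (e : AlgExtension G A ρ) : Prop :=
  ∃ σ : AlgGroupHom G e.E, ∀ g ∈ G.carrier, e.q.toFun (σ.toFun g) = g

/-- Equivalence of extensions (via a morphism over `G` and under `A`;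
such a morphism is automatically an isomorphism). -/
def Equiv (e₁ e₂ : AlgExtension G A ρ) : Prop :=
  ∃ f : AlgGroupHom e₁.E e₂.E,
    (∀ a ∈ A.carrier, f.toFun (e₁.i.toFun a) = e₂.i.toFun a) ∧
    (∀ x ∈ e₁.E.carrier, e₂.q.toFun (f.toFun x) = e₁.q.toFun x)

/-- `e₃` is a Baer sum of `e₁` and `e₂`: there is a regular map from the fiber
product `E₁ ×_G E₂` to `E₃` which is multiplicative, lies over `G` and
restricts to the multiplication `A × A → A` on the kernels.  (This
characterizes the Baer sum up to equivalence.) -/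
def IsBaerSum (e₁ e₂ e₃ : AlgExtension G A ρ) : Prop :=
  ∃ h : Pt (e₁.E.n + e₂.E.n) → Pt e₃.E.n,
    IsRegularOn {z : Pt (e₁.E.n + e₂.E.n) | Pt.left z ∈ e₁.E.carrier ∧
      Pt.right z ∈ e₂.E.carrier ∧ e₁.q.toFun (Pt.left z) = e₂.q.toFun (Pt.right z)} h ∧
    (∀ x ∈ e₁.E.carrier, ∀ y ∈ e₂.E.carrier, e₁.q.toFun x = e₂.q.toFun y →
      h (Fin.append x y) ∈ e₃.E.carrier) ∧
    (∀ x x' y y', x ∈ e₁.E.carrier → x' ∈ e₁.E.carrier → y ∈ e₂.E.carrier →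
      y' ∈ e₂.E.carrier → e₁.q.toFun x = e₂.q.toFun y → e₁.q.toFun x' = e₂.q.toFun y' →
      h (Fin.append (e₁.E.mul x x') (e₂.E.mul y y')) =
        e₃.E.mul (h (Fin.append x y)) (h (Fin.append x' y'))) ∧
    (∀ x ∈ e₁.E.carrier, ∀ y ∈ e₂.E.carrier, e₁.q.toFun x = e₂.q.toFun y →
      e₃.q.toFun (h (Fin.append x y)) = e₁.q.toFun x) ∧
    (∀ a ∈ A.carrier, ∀ b ∈ A.carrier,
      h (Fin.append (e₁.i.toFun a) (e₂.i.toFun b)) = e₃.i.toFun (A.mul a b))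

end AlgExtension

/-- A realization of the abelian group `Ext_alg(G, A)` of equivalence classes
of extensions of `G` by `A` (inducing the action `ρ`), with addition given by
the Baer sum, and zero element the class of split extensions. -/
structure IsExtGroup (G A : AffAlgGroup) (ρ : AlgAction G A)
    (Ext : Type) [AddCommGroup Ext] : Prop where
  exists_cls : ∃ cls : AlgExtension G A ρ → Ext,
    Function.Surjective cls ∧
    (∀ e₁ e₂, cls e₁ = cls e₂ ↔ Relation.EqvGen AlgExtension.Equiv e₁ e₂) ∧
    (∀ e, cls e = 0 ↔ e.Splits) ∧
    (∀ e₁ e₂ e₃, AlgExtension.IsBaerSum e₁ e₂ e₃ → cls e₁ + cls e₂ = cls e₃)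

/-- The class map itself, when we need to name it. -/
structure ExtClassMap (G A : AffAlgGroup) (ρ : AlgAction G A)
    (Ext : Type) [AddCommGroup Ext] : Type where
  cls : AlgExtension G A ρ → Ext
  surj : Function.Surjective cls
  cls_eq_iff : ∀ e₁ e₂, cls e₁ = cls e₂ ↔ Relation.EqvGen AlgExtension.Equiv e₁ e₂
  cls_eq_zero_iff : ∀ e, cls e = 0 ↔ e.Splits
  cls_baer : ∀ e₁ e₂ e₃, AlgExtension.IsBaerSum e₁ e₂ e₃ → cls e₁ + cls e₂ = cls e₃

/-- An algebraic subgroup of `G`. -/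
structure AlgSubgroup (G : AffAlgGroup) : Type where
  carrier : Set (Pt G.n)
  subset : carrier ⊆ G.carrier
  isAlgebraic : IsAlgebraicSet carrier
  one_mem : G.one ∈ carrier
  mul_mem : ∀ {x y : Pt G.n}, x ∈ carrier → y ∈ carrier → G.mul x y ∈ carrier
  inv_mem : ∀ {x : Pt G.n}, x ∈ carrier → G.inv x ∈ carrier

namespace AlgSubgroup

variable {G : AffAlgGroup}

/-- An algebraic subgroup is itself an affine algebraic group. -/
def toGrp (H : AlgSubgroup G) : AffAlgGroup where
  n := G.n
  carrier := H.carrier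
  isAlgebraic := H.isAlgebraic
  one := G.one
  one_mem := H.one_mem
  mul := G.mul
  inv := G.inv
  mul_mem := H.mul_mem
  inv_mem := H.inv_mem
  mul_assoc' hx hy hz := G.mul_assoc' (H.subset hx) (H.subset hy) (H.subset hz)
  one_mul' hx := G.one_mul' (H.subset hx)
  mul_one' hx := G.mul_one' (H.subset hx)
  inv_mul' hx := G.inv_mul' (H.subset hx)
  mul_regular := by
    obtain ⟨P, hP⟩ := G.mul_regular
    exact ⟨P, fun z hz => hP z ⟨H.subset hz.1, H.subset hz.2⟩⟩
  inv_regular := by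
    obtain ⟨P, hP⟩ := G.inv_regular
    exact ⟨P, fun x hx => hP x (H.subset hx)⟩

def IsNormal (H : AlgSubgroup G) : Prop :=
  ∀ g ∈ G.carrier, ∀ x ∈ H.carrier, G.mul g (G.mul x (G.inv g)) ∈ H.carrier

/-- `H` is the unipotent radical of `G`: the largest connected normal
unipotent algebraic subgroup. -/
def IsUnipotentRadical (H : AlgSubgroup G) : Prop :=
  H.IsNormal ∧ H.toGrp.IsConnected ∧ H.toGrp.IsUnipotent ∧
    ∀ K : AlgSubgroup G, K.IsNormal → K.toGrp.IsConnected → K.toGrp.IsUnipotent →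
      K.carrier ⊆ H.carrier

/-- `G` is reductive: its unipotent radical is trivial. -/
def _root_.AffAlgGroup.IsReductive (G : AffAlgGroup) : Prop :=
  ∀ K : AlgSubgroup G, K.IsNormal → K.toGrp.IsConnected → K.toGrp.IsUnipotent →
    K.carrier = {G.one}

end AlgSubgroup

/-- A Levi decomposition `G = G_u ⋊ G_red` of `G`:  `Gu` is the unipotent
radical and `L` is a connected reductive algebraic subgroup with
`Gu ∩ L = 1` and `Gu · L = G`. -/
structure LeviDecomposition (G : AffAlgGroup) : Type where
  Gu : AlgSubgroup G
  L : AlgSubgroup G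
  Gu_radical : Gu.IsUnipotentRadical
  L_connected : L.toGrp.IsConnected
  L_reductive : L.toGrp.IsReductive
  inter : Gu.carrier ∩ L.carrier = {G.one}
  decomp : ∀ x ∈ G.carrier, ∃ u ∈ Gu.carrier, ∃ l ∈ L.carrier, x = G.mul u l

/-- The group homomorphism on point groups induced by a morphism of algebraic
groups. -/
def AlgGroupHom.toGpHom {G H : AffAlgGroup} (f : AlgGroupHom G H) : G.Gp →* H.Gp :=
  MonoidHom.mk' (fun x => ⟨f.toFun x.1, f.maps_to x.2⟩)
    (fun a b => Subtype.ext (f.map_mul a.2 b.2))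

/-- The subgroup of the point group underlying an algebraic subgroup. -/
def AlgSubgroup.toSubgroup {G : AffAlgGroup} (H : AlgSubgroup G) : Subgroup G.Gp where
  carrier := {x : G.Gp | x.1 ∈ H.carrier}
  one_mem' := H.one_mem
  mul_mem' := fun ha hb => H.mul_mem ha hb
  inv_mem' := fun ha => H.inv_mem ha

/-- Iterated product (powers) in an algebraic group. -/
def AffAlgGroup.pow (G : AffAlgGroup) (x : Pt G.n) : ℕ → Pt G.n
  | 0 => G.one
  | k + 1 => G.mul x (G.pow x k)

/-- The inclusion homomorphism of an algebraic subgroup. -/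
def AlgSubgroup.incl {A : AffAlgGroup} (H : AlgSubgroup A) : H.toGrp.Gp →* A.Gp :=
  MonoidHom.mk' (fun x => ⟨x.1, H.subset x.2⟩) (fun _ _ => rfl)

/-! ### The canonical covering `G̃ = G_u ⋊ (Z × G̃'_red) → G` -/

/-- Data of the canonical algebraic covering `q_G : G̃ → G` attached to a Levi
decomposition `G = G_u ⋊ L`: here `Z` is the identity component of the center
of `L` (the maximal connected central algebraic subgroup), `Lder = [L, L]` is
the derived group of `L`, and `G̃ = G_u ⋊ (Z × G̃'_red)`, where `G̃'_red` is the
universal (simply connected) algebraic covering group of `Lder`. -/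
structure CoveringData (G : AffAlgGroup) (LD : LeviDecomposition G) : Type where
  /-- the identity component of the center of the Levi subgroup `L` -/
  Z : AlgSubgroup G
  Z_sub : Z.carrier ⊆ LD.L.carrier
  Z_central : ∀ z ∈ Z.carrier, ∀ l ∈ LD.L.carrier, G.mul z l = G.mul l z
  Z_connected : Z.toGrp.IsConnected
  Z_max : ∀ K : AlgSubgroup G, K.carrier ⊆ LD.L.carrier →
    (∀ z ∈ K.carrier, ∀ l ∈ LD.L.carrier, G.mul z l = G.mul l z) →
    K.toGrp.IsConnected → K.carrier ⊆ Z.carrier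
  /-- the derived group `[L, L]` of the Levi subgroup -/
  Lder : AlgSubgroup G
  Lder_sub : Lder.carrier ⊆ LD.L.carrier
  Lder_comm : ∀ x ∈ LD.L.carrier, ∀ y ∈ LD.L.carrier,
    G.mul x (G.mul y (G.mul (G.inv x) (G.inv y))) ∈ Lder.carrier
  Lder_min : ∀ K : AlgSubgroup G,
    (∀ x ∈ LD.L.carrier, ∀ y ∈ LD.L.carrier,
      G.mul x (G.mul y (G.mul (G.inv x) (G.inv y))) ∈ K.carrier) →
    Lder.carrier ⊆ K.carrier
  /-- the covering group `G̃` and the covering morphism -/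
  Gt : AffAlgGroup
  qG : AlgGroupHom Gt G
  qG_surj : ∀ g ∈ G.carrier, ∃ x ∈ Gt.carrier, qG.toFun x = g
  /-- the three factors of `G̃ = G_u ⋊ (Z × G̃'_red)` -/
  Gu' : AlgSubgroup Gt
  Zc : AlgSubgroup Gt
  Gs : AlgSubgroup Gt
  Gu'_normal : Gu'.IsNormal
  Zc_Gs_comm : ∀ z ∈ Zc.carrier, ∀ s ∈ Gs.carrier, Gt.mul z s = Gt.mul s z
  Zc_Gs_inter : Zc.carrier ∩ Gs.carrier = {Gt.one}
  decomp : ∀ x ∈ Gt.carrier, ∃ u ∈ Gu'.carrier, ∃ z ∈ Zc.carrier, ∃ s ∈ Gs.carrier,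
    x = Gt.mul u (Gt.mul z s)
  levi_inter : {x | x ∈ Gu'.carrier ∧
      ∃ z ∈ Zc.carrier, ∃ s ∈ Gs.carrier, x = Gt.mul z s} = {Gt.one}
  /-- `q_G` restricts to an isomorphism `G_u' ≅ G_u` -/
  qG_Gu'_inj : Set.InjOn qG.toFun Gu'.carrier
  qG_Gu'_img : qG.toFun '' Gu'.carrier = LD.Gu.carrier
  /-- `q_G` restricts to an isomorphism `Z_c ≅ Z` -/
  qG_Zc_inj : Set.InjOn qG.toFun Zc.carrier
  qG_Zc_img : qG.toFun '' Zc.carrier = Z.carrier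
  /-- `q_G` maps `G̃'_red` onto `[L, L]`, and `G̃'_red` is connected and simply
  connected: it is the universal algebraic covering group of `[L, L]` -/
  qG_Gs_img : qG.toFun '' Gs.carrier = Lder.carrier
  Gs_connected : Gs.toGrp.IsConnected
  Gs_simplyConnected : ∀ γ : FundamentalGroup Gs.toGrp.Gp ⟨Gt.one, Gs.one_mem⟩, γ = 1
  /-- the kernel `Π_G` of the covering is finite and central -/
  ker_finite : {x ∈ Gt.carrier | qG.toFun x = G.one}.Finite
  ker_central : ∀ x ∈ Gt.carrier, qG.toFun x = G.one →
    ∀ y ∈ Gt.carrier, Gt.mul x y = Gt.mul y x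

namespace CoveringData

variable {G : AffAlgGroup} {LD : LeviDecomposition G}

/-- The kernel `Π_G` of the covering `q_G : G̃ → G`, as a subgroup of the point
group of `G̃`. -/
def PiG (CD : CoveringData G LD) : Subgroup CD.Gt.Gp := CD.qG.toGpHom.ker

/-- The fundamental group `π₁(G'_red)` of the derived group of the Levi
subgroup, realized as the kernel of `G̃'_red → G'_red`, a subgroup of `Π_G`. -/
def pi1Gs (CD : CoveringData G LD) : Subgroup CD.Gt.Gp where
  carrier := {x : CD.Gt.Gp | x.1 ∈ CD.Gs.carrier ∧ x ∈ CD.PiG}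
  one_mem' := ⟨CD.Gs.one_mem, one_mem CD.PiG⟩
  mul_mem' := fun hx hy => ⟨CD.Gs.mul_mem hx.1 hy.1, mul_mem hx.2 hy.2⟩
  inv_mem' := fun hx => ⟨CD.Gs.inv_mem hx.1, inv_mem hx.2⟩

lemma pi1Gs_le_PiG (CD : CoveringData G LD) : CD.pi1Gs ≤ CD.PiG := fun _ hx => hx.2

/-- `ext` is (equivalent to) the pushout extension `γ_* G̃ = (A × G̃)/Γ(γ)` of
`G` by `A` along `γ : Π_G → A`:  this is characterized by the existence of a
morphism `h : G̃ → E` over `G` restricting to `γ` on `Π_G`. -/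
def IsPushoutOf (CD : CoveringData G LD) {A : AffAlgGroup} {ρ : AlgAction G A}
    (γ : ↥CD.PiG →* A.Gp) (ext : AlgExtension G A ρ) : Prop :=
  ∃ h : AlgGroupHom CD.Gt ext.E,
    (∀ x ∈ CD.Gt.carrier, ext.q.toFun (h.toFun x) = CD.qG.toFun x) ∧
    (∀ x : ↥CD.PiG, h.toFun x.1.1 = ext.i.toFun (γ x).1)

end CoveringData

/-- A dominant morphism of finite type with Noetherian reduced target has an image containing
a nonempty basic open set. -/
theorem exists_basicOpen_subset_range_comap {R S : Type*} [CommRing R] [CommRing S]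
    [IsNoetherianRing R] [Nontrivial R] (f : R →+* S) (hf : Function.Injective f)
    (hft : f.FiniteType) :
    ∃ a : R, ¬ IsNilpotent a ∧
      ∀ P : Ideal R, P.IsPrime → a ∉ P → ∃ Q : Ideal S, Q.IsPrime ∧ Q.comap f = P := by
  obtain ⟨T, hT⟩ := PrimeSpectrum.exists_constructibleSetData_iff.mpr
    (PrimeSpectrum.isConstructible_range_comap (RingHom.FinitePresentation.of_finiteType.mp hft))
  obtain ⟨⟨p, hp⟩⟩ : Nonempty (minimalPrimes R) := Ideal.nonempty_minimalPrimes bot_ne_top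
  have hpp : p.IsPrime := hp.1.1
  obtain ⟨q, hq, hqp⟩ := Ideal.exists_comap_eq_of_mem_minimalPrimes_of_injective hf p hp
  have hmem : (⟨p, hpp⟩ : PrimeSpectrum R) ∈ T.toSet := by
    rw [hT]
    exact ⟨⟨q, hq⟩, PrimeSpectrum.ext hqp⟩
  obtain ⟨C, hC, hpC⟩ : ∃ C ∈ T, (⟨p, hpp⟩ : PrimeSpectrum R) ∈ C.toSet := by
    simpa [PrimeSpectrum.ConstructibleSetData.toSet] using hmem
  have hfin : (minimalPrimes R).Finite := minimalPrimes.finite_of_isNoetherianRing R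
  obtain ⟨b, hb, hbp⟩ : ∃ b, (∀ p' ∈ minimalPrimes R, p' ≠ p → b ∈ p') ∧ b ∉ p := by
    by_contra! h
    have hle : (hfin.toFinset.erase p).inf id ≤ p := by
      intro b hb
      refine h b fun p' hp' hne => ?_
      have hmem : p' ∈ hfin.toFinset.erase p := by simp [hne, hp']
      exact Finset.inf_le (f := id) hmem hb
    obtain ⟨p', hp', hle'⟩ := (Ideal.IsPrime.inf_le' hpp).mp hle
    simp only [Finset.mem_erase, Set.Finite.mem_toFinset] at hp'
    exact hp'.1 (le_antisymm hle' (hp.2 hp'.2.1 hle'))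
  have hfp : C.f ∉ p := fun h => hpC.2 (by simpa [PrimeSpectrum.mem_zeroLocus] using h)
  have hgp : ∀ i, C.g i ∈ p := fun i => hpC.1 ⟨i, rfl⟩
  refine ⟨b * C.f, fun hn => ?_, fun P hP ha => ?_⟩
  · exact (hpp.mem_or_mem (nilpotent_iff_mem_prime.mp hn p hpp)).elim hbp hfp
  · have hPT : (⟨P, hP⟩ : PrimeSpectrum R) ∈ T.toSet := by
      have : (⟨P, hP⟩ : PrimeSpectrum R) ∈ C.toSet := by
        refine ⟨?_, fun h => ha (P.mul_mem_left _ (h rfl))⟩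
        rintro _ ⟨i, rfl⟩
        have hnil : IsNilpotent (b * C.g i) := by
          rw [← mem_nilradical, nilradical, ← Ideal.sInf_minimalPrimes]
          refine (Submodule.mem_sInf).mpr fun p' hp' => ?_
          by_cases h : p' = p
          · exact h ▸ p.mul_mem_left _ (hgp i)
          · exact Ideal.mul_mem_right _ p' (hb p' hp' h)
        exact (hP.mem_or_mem (nilpotent_iff_mem_prime.mp hnil P hP)).resolve_left
          fun h => ha (P.mul_mem_right _ h)
      simp only [PrimeSpectrum.ConstructibleSetData.toSet, Set.mem_iUnion]
      exact ⟨C, hC, this⟩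
    rw [hT] at hPT
    obtain ⟨Q, hQ⟩ := hPT
    exact ⟨Q.asIdeal, Q.2, congrArg PrimeSpectrum.asIdeal hQ⟩

/-- Nullstellensatz: maximal ideals of finitely generated `ℂ`-algebras are kernels of points. -/
theorem exists_algHom_ker_eq_of_isMaximal {B : Type*} [CommRing B] [Algebra ℂ B]
    [Algebra.FiniteType ℂ B] (M : Ideal B) [hM : M.IsMaximal] :
    ∃ e : B →ₐ[ℂ] ℂ, RingHom.ker e = M := by
  let : Field (B ⧸ M) := Ideal.Quotient.field M
  have : Module.Finite ℂ (B ⧸ M) := finite_of_finite_type_of_isJacobsonRing ℂ (B ⧸ M)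
  let ψ := AlgEquiv.ofBijective (Algebra.ofId ℂ (B ⧸ M))
    IsAlgClosed.algebraMap_bijective_of_isIntegral
  refine ⟨(ψ.symm : (B ⧸ M) →ₐ[ℂ] ℂ).comp (Ideal.Quotient.mkₐ ℂ M), ?_⟩
  ext x
  simp [RingHom.mem_ker, Ideal.Quotient.eq_zero_iff_mem]

/-- Two `ℂ`-points with comparable kernels are equal. -/
theorem algHom_eq_of_ker_le {A : Type*} [CommRing A] [Algebra ℂ A] (e e' : A →ₐ[ℂ] ℂ)
    (h : RingHom.ker e ≤ RingHom.ker e') : e = e' := by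
  ext x
  have : x - algebraMap ℂ A (e x) ∈ RingHom.ker e := by simp [RingHom.mem_ker]
  have := h this
  rw [RingHom.mem_ker, map_sub, AlgHom.commutes, sub_eq_zero] at this
  exact this.symm

/-- If `A ⊆ B` are finitely generated reduced `ℂ`-algebras, then for some nonzero `a` in `A`
all points of `A` at which `a` does not vanish extend to points of `B`. -/
theorem exists_forall_algHom_extends {A B : Type*} [CommRing A] [CommRing B] [Algebra ℂ A]
    [Algebra ℂ B] [Algebra.FiniteType ℂ A] [Algebra.FiniteType ℂ B] [Nontrivial A]
    (f : A →ₐ[ℂ] B) (hf : Function.Injective f) :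
    ∃ a : A, a ≠ 0 ∧ ∀ e : A →ₐ[ℂ] ℂ, e a ≠ 0 → ∃ e' : B →ₐ[ℂ] ℂ, e'.comp f = e := by
  have : IsNoetherianRing A := Algebra.FiniteType.isNoetherianRing ℂ A
  have hft : (f : A →+* B).FiniteType := by
    refine RingHom.FiniteType.of_comp_finiteType (f := algebraMap ℂ A) ?_
    rw [AlgHom.comp_algebraMap]
    exact (RingHom.finiteType_algebraMap).mpr inferInstance
  obtain ⟨a, ha, H⟩ := exists_basicOpen_subset_range_comap (f : A →+* B) hf hft
  refine ⟨a, fun h => ha (h ▸ IsNilpotent.zero), fun e he => ?_⟩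
  obtain ⟨Q, hQ, hQe⟩ := H (RingHom.ker e) (RingHom.ker_isPrime _) he
  obtain ⟨M, hM, hQM⟩ := Q.exists_le_maximal hQ.ne_top
  obtain ⟨e', he'⟩ := exists_algHom_ker_eq_of_isMaximal M
  refine ⟨e', (algHom_eq_of_ker_le _ _ fun x hx => ?_).symm⟩
  rw [← hQe] at hx
  have : f x ∈ RingHom.ker e' := he' ▸ hQM hx
  exact this

section FunctionAlgebras

variable {X Y W Γ : Type*}

/-- Pullback of functions along a map. -/
def pullbackFun (f : X → Y) : (Y → ℂ) →ₐ[ℂ] (X → ℂ) :=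
  AlgHom.pi fun x => Pi.evalAlgHom ℂ (fun _ => ℂ) (f x)

@[simp]
theorem pullbackFun_apply (f : X → Y) (b : Y → ℂ) (x : X) : pullbackFun f b x = b (f x) := rfl

/-- Evaluation at a point on an algebra of functions. -/
def evalPoint (A : Subalgebra ℂ (X → ℂ)) (x : X) : A →ₐ[ℂ] ℂ :=
  (Pi.evalAlgHom ℂ (fun _ => ℂ) x).comp A.val

@[simp]
theorem evalPoint_apply (A : Subalgebra ℂ (X → ℂ)) (x : X) (a : A) :
    evalPoint A x a = (a : X → ℂ) x := rfl

/-- Maps pulling back the functions in `B` to functions in `A`. -/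
def IsRegularMap (A : Subalgebra ℂ (X → ℂ)) (B : Subalgebra ℂ (Y → ℂ)) (f : X → Y) : Prop :=
  B ≤ A.comap (pullbackFun f)

theorem IsRegularMap.mem {A : Subalgebra ℂ (X → ℂ)} {B : Subalgebra ℂ (Y → ℂ)} {f : X → Y}
    (hf : IsRegularMap A B f) {b : Y → ℂ} (hb : b ∈ B) : (fun x => b (f x)) ∈ A :=
  hf hb

/-- `A` is finitely generated and `X` is its maximal spectrum up to repetition of points. -/
structure IsAffineAlgebra (A : Subalgebra ℂ (X → ℂ)) : Prop where
  fg : A.FG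
  exists_eq_eval : ∀ e : A →ₐ[ℂ] ℂ, ∃ x : X, e = evalPoint A x

/-- `A` separates the points of `X`. -/
def SeparatesPts (A : Subalgebra ℂ (X → ℂ)) : Prop :=
  ∀ x y : X, (∀ a ∈ A, a x = a y) → x = y

/-- Translations and inversion are regular. -/
structure IsTranslationInvariant [Group Γ] (A : Subalgebra ℂ (Γ → ℂ)) : Prop where
  left : ∀ g : Γ, IsRegularMap A A (fun x => g * x)
  right : ∀ g : Γ, IsRegularMap A A (fun x => x * g)
  inv : IsRegularMap A A (fun x => x⁻¹)

/-- The algebra of functions on a product generated by functions on the factors. -/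
def boxAlgebra (A : Subalgebra ℂ (X → ℂ)) (B : Subalgebra ℂ (Y → ℂ)) :
    Subalgebra ℂ (X × Y → ℂ) :=
  A.map (pullbackFun Prod.fst) ⊔ B.map (pullbackFun Prod.snd)

theorem isRegularMap_fst (A : Subalgebra ℂ (X → ℂ)) (B : Subalgebra ℂ (Y → ℂ)) :
    IsRegularMap (boxAlgebra A B) A Prod.fst :=
  Subalgebra.map_le.mp le_sup_left

theorem isRegularMap_snd (A : Subalgebra ℂ (X → ℂ)) (B : Subalgebra ℂ (Y → ℂ)) :
    IsRegularMap (boxAlgebra A B) B Prod.snd :=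
  Subalgebra.map_le.mp le_sup_right

theorem IsRegularMap.comp {A : Subalgebra ℂ (X → ℂ)} {B : Subalgebra ℂ (Y → ℂ)}
    {D : Subalgebra ℂ (W → ℂ)} {g : Y → W} {f : X → Y} (hg : IsRegularMap B D g)
    (hf : IsRegularMap A B f) : IsRegularMap A D (fun x => g (f x)) :=
  fun _ hd => hf (hg hd)

theorem IsRegularMap.prodMk {A : Subalgebra ℂ (X → ℂ)} {B : Subalgebra ℂ (Y → ℂ)}
    {D : Subalgebra ℂ (W → ℂ)} {f : W → X} {g : W → Y} (hf : IsRegularMap D A f)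
    (hg : IsRegularMap D B g) : IsRegularMap D (boxAlgebra A B) (fun w => (f w, g w)) := by
  refine sup_le ?_ ?_ <;> rw [Subalgebra.map_le]
  · exact fun a ha => hf ha
  · exact fun b hb => hg hb

theorem isRegularMap_const (A : Subalgebra ℂ (X → ℂ)) (B : Subalgebra ℂ (Y → ℂ)) (y : Y) :
    IsRegularMap A B (fun _ => y) :=
  fun b _ => A.algebraMap_mem (b y)

theorem isRegularMap_id (A : Subalgebra ℂ (X → ℂ)) : IsRegularMap A A (fun x => x) :=
  fun _ ha => ha

theorem IsAffineAlgebra.box {A : Subalgebra ℂ (X → ℂ)} {B : Subalgebra ℂ (Y → ℂ)}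
    (hA : IsAffineAlgebra A) (hB : IsAffineAlgebra B) : IsAffineAlgebra (boxAlgebra A B) where
  fg := (hA.fg.map _).sup (hB.fg.map _)
  exists_eq_eval e := by
    let iA : A →ₐ[ℂ] boxAlgebra A B :=
      ((pullbackFun Prod.fst).comp A.val).codRestrict _ fun a => isRegularMap_fst A B a.2
    let iB : B →ₐ[ℂ] boxAlgebra A B :=
      ((pullbackFun Prod.snd).comp B.val).codRestrict _ fun b => isRegularMap_snd A B b.2
    obtain ⟨x, hx⟩ := hA.exists_eq_eval (e.comp iA)
    obtain ⟨y, hy⟩ := hB.exists_eq_eval (e.comp iB)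
    refine ⟨(x, y), ?_⟩
    let E := AlgHom.equalizer e (evalPoint (boxAlgebra A B) (x, y))
    have hle : boxAlgebra A B ≤ E.map (boxAlgebra A B).val := by
      refine sup_le ?_ ?_ <;> rw [Subalgebra.map_le]
      · exact fun a ha => ⟨iA ⟨a, ha⟩,
          (AlgHom.mem_equalizer _ _ _).mpr (DFunLike.congr_fun hx ⟨a, ha⟩), rfl⟩
      · exact fun b hb => ⟨iB ⟨b, hb⟩,
          (AlgHom.mem_equalizer _ _ _).mpr (DFunLike.congr_fun hy ⟨b, hb⟩), rfl⟩
    ext ⟨F, hF⟩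
    obtain ⟨F', hF', rfl⟩ := hle hF
    exact hF'

/-- A subgroup that is the image of a regular map from an affine variety is Zariski closed. -/
theorem mem_of_mem_closure_of_range_eq [Group Γ] {A : Subalgebra ℂ (Γ → ℂ)} (hA : A.FG)
    (hsep : SeparatesPts A) (hinv : IsTranslationInvariant A) {B : Subalgebra ℂ (W → ℂ)}
    (hB : IsAffineAlgebra B) {φ : W → Γ} (hφ : IsRegularMap B A φ) {C : Subgroup Γ}
    (hC : Set.range φ = C) {x : Γ} (hx : ∀ a ∈ A, (∀ c ∈ C, a c = 0) → a x = 0) : x ∈ C := by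
  have hmem : ∀ w, φ w ∈ C := fun w => hC.subset ⟨w, rfl⟩
  have hex : ∀ c ∈ C, ∃ w, φ w = c := fun c hc => hC.superset hc
  obtain ⟨w₀, -⟩ := hex 1 C.one_mem
  have : Algebra.FiniteType ℂ A := A.fg_iff_finiteType.mp hA
  have : Algebra.FiniteType ℂ B := B.fg_iff_finiteType.mp hB.fg
  let f : A →ₐ[ℂ] B := ((pullbackFun φ).comp A.val).codRestrict _ fun a => hφ a.2
  have hker : ∀ a : A, a ∈ RingHom.ker f ↔ ∀ c ∈ C, (a : Γ → ℂ) c = 0 := by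
    intro a
    rw [RingHom.mem_ker]
    constructor
    · intro h c hc
      obtain ⟨w, rfl⟩ := hex c hc
      exact congrFun (congrArg Subtype.val h) w
    · intro h
      exact Subtype.ext (funext fun w => h _ (hmem w))
  have : Nontrivial (A ⧸ RingHom.ker f) := by
    refine Ideal.Quotient.nontrivial_iff.mpr fun h => ?_
    have h1 : (1 : A) ∈ RingHom.ker f := h ▸ Submodule.mem_top
    exact one_ne_zero ((hker 1).mp h1 1 C.one_mem)
  obtain ⟨a, ha0, ha⟩ := exists_forall_algHom_extends (A := A ⧸ RingHom.ker f) (B := B)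
    (Ideal.Quotient.liftₐ (RingHom.ker f) f fun _ h => h)
    (by
      rw [injective_iff_map_eq_zero]
      intro b hb
      obtain ⟨b, rfl⟩ := Ideal.Quotient.mk_surjective b
      exact Ideal.Quotient.eq_zero_iff_mem.mpr hb)
  obtain ⟨a, rfl⟩ := Ideal.Quotient.mk_surjective a
  have hopen : ∀ y : Γ, (∀ b ∈ A, (∀ c ∈ C, b c = 0) → b y = 0) → (a : Γ → ℂ) y ≠ 0 →
      y ∈ C := by
    intro y hy hay
    obtain ⟨e, he⟩ := ha (Ideal.Quotient.liftₐ (RingHom.ker f) (evalPoint A y)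
      fun b hb => hy b b.2 ((hker b).mp hb)) hay
    obtain ⟨w, rfl⟩ := hB.exists_eq_eval e
    have : φ w = y := hsep _ _ fun b hb =>
      DFunLike.congr_fun he (Ideal.Quotient.mk _ (⟨b, hb⟩ : A))
    exact this ▸ hmem w
  obtain ⟨c₀, hc₀, hac₀⟩ : ∃ c ∈ C, (a : Γ → ℂ) c ≠ 0 := by
    by_contra! h
    exact ha0 (Ideal.Quotient.eq_zero_iff_mem.mpr ((hker a).mpr h))
  by_contra hxC
  have hcl : ∀ c ∈ C, ∀ b ∈ A, (∀ c ∈ C, b c = 0) → b (x⁻¹ * c) = 0 := by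
    intro c hc b hb hbC
    exact hx _ ((hinv.right c).comp hinv.inv hb) fun c' hc' =>
      hbC _ (C.mul_mem (C.inv_mem hc') hc)
  have hb := hx _ ((hinv.left x⁻¹).comp (hinv.right c₀) a.2) fun c hc => by
    by_contra hne
    have := hopen (x⁻¹ * (c * c₀)) (hcl _ (C.mul_mem hc hc₀)) hne
    rw [C.mul_mem_cancel_right (C.mul_mem hc hc₀), C.inv_mem_iff] at this
    exact hxC this
  refine hac₀ ?_
  simpa using hb

end FunctionAlgebras

section Characters

open scoped Polynomial

variable {W Γ : Type*} [Group Γ]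

/-- A homomorphism to `ℂˣ` that becomes regular after multiplication by a nonzero regular
function is regular. -/
theorem mem_of_mul_mem {A : Subalgebra ℂ (Γ → ℂ)} (hA : IsAffineAlgebra A)
    (hinv : IsTranslationInvariant A) (f : Γ →* ℂˣ) {b : Γ → ℂ} (hb : b ∈ A) (hb0 : b ≠ 0)
    (hfb : (fun x => (f x : ℂ) * b x) ∈ A) : (fun x => (f x : ℂ)) ∈ A := by
  have : Algebra.FiniteType ℂ A := A.fg_iff_finiteType.mp hA.fg
  let F : Γ → ℂ := fun x => (f x : ℂ)
  let I : Ideal A :=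
    { carrier := {c | F * (c : Γ → ℂ) ∈ A}
      add_mem' := fun {c d} hc hd => by
        simpa [mul_add] using A.add_mem hc hd
      zero_mem' := by simp
      smul_mem' := fun c d hd => by
        have := A.mul_mem c.2 hd
        rw [mul_left_comm] at this
        exact this }
  have hI : I = ⊤ := by
    by_contra hne
    obtain ⟨M, hM, hIM⟩ := I.exists_le_maximal hne
    obtain ⟨e, rfl⟩ := exists_algHom_ker_eq_of_isMaximal M
    obtain ⟨x, rfl⟩ := hA.exists_eq_eval e
    obtain ⟨y, hy⟩ := Function.ne_iff.mp hb0
    have hmem : (⟨fun z => b (z * (x⁻¹ * y)), hinv.right _ hb⟩ : A) ∈ I := by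
      have h := A.smul_mem ((hinv.right (x⁻¹ * y)).mem hfb) ((f (x⁻¹ * y))⁻¹ : ℂˣ).1
      change F * (fun z => b (z * (x⁻¹ * y))) ∈ A
      convert h using 1
      funext z
      simp only [F, Pi.mul_apply, Pi.smul_apply, smul_eq_mul, map_mul f z, Units.val_mul]
      have h0 := Units.inv_mul (f (x⁻¹ * y))
      linear_combination (-(f z : ℂ) * b (z * (x⁻¹ * y))) * h0
    have := hIM hmem
    rw [RingHom.mem_ker] at this
    simp only [evalPoint_apply, mul_inv_cancel_left] at this
    exact hy this
  have h1 : (1 : A) ∈ I := hI ▸ Submodule.mem_top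
  have h2 : F * ((1 : A) : Γ → ℂ) ∈ A := h1
  simpa using h2

theorem aeval_apply_eq_eval_map {X : Type*} {A : Subalgebra ℂ (X → ℂ)} (f : X → ℂ) (P : A[X])
    (x : X) : Polynomial.aeval f P x = (P.map (evalPoint A x : A →+* ℂ)).eval (f x) := by
  rw [Polynomial.aeval_def, Polynomial.eval₂_eq_sum_range, Polynomial.eval_map,
    Polynomial.eval₂_eq_sum_range, Finset.sum_apply]
  rfl

/-- A homomorphism to `ℂˣ` that is algebraic over the regular functions has a regular power. -/
theorem exists_pow_mem_of_aeval_eq_zero {A : Subalgebra ℂ (Γ → ℂ)} (hA : IsAffineAlgebra A)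
    (hinv : IsTranslationInvariant A) (f : Γ →* ℂˣ) {P : A[X]} (hP : P ≠ 0)
    (hfP : Polynomial.aeval (fun x => (f x : ℂ)) P = 0) :
    ∃ e, 0 < e ∧ e ≤ P.natDegree ∧ (fun x => ((f ^ e) x : ℂ)) ∈ A := by
  let F : Γ → ℂ := fun x => (f x : ℂ)
  induction hn : P.support.card using Nat.strong_induction_on generalizing P with
  | _ n ih =>
  obtain ⟨i, hi⟩ := Polynomial.nonempty_support_iff.mpr hP
  have hcard : 1 < P.support.card := by
    by_contra! hle
    have hsupp : P.support = {i} := by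
      refine (Finset.eq_of_subset_of_card_le (by simpa using hi) (by simpa using hle)).symm
    refine Polynomial.mem_support_iff.mp hi (Subtype.ext (funext fun x => ?_))
    have := congrFun hfP x
    rw [aeval_apply_eq_eval_map, Polynomial.eval_map, Polynomial.eval₂_def, Polynomial.sum_def,
      hsupp,
      Finset.sum_singleton] at this
    simpa using this
  obtain ⟨j, hj, hji⟩ := Finset.exists_mem_ne hcard i
  wlog hij : i < j generalizing i j
  · exact this j hj i hi hji.symm (by omega)
  let τ (g : Γ) : A →ₐ[ℂ] A :=
    ((pullbackFun (fun x => x * g)).comp A.val).codRestrict _ fun a => hinv.right g a.2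
  let c (g : Γ) : A := algebraMap ℂ A (f g)
  let S (g : Γ) : A[X] := (P.map (τ g : A →+* A)).comp (Polynomial.C (c g) * Polynomial.X)
  have hScoeff (g : Γ) (k : ℕ) : (S g).coeff k = τ g (P.coeff k) * c g ^ k := by
    simp [S, Polynomial.comp_C_mul_X_coeff]
  have hS (g : Γ) : Polynomial.aeval F (S g) = 0 := by
    funext x
    have h := congrFun hfP (x * g)
    rw [aeval_apply_eq_eval_map] at h ⊢
    have hc : (evalPoint A x : A →+* ℂ) (c g) = f g := (evalPoint A x).commutes _
    have hτ : (evalPoint A x : A →+* ℂ).comp (τ g : A →+* A) = evalPoint A (x * g) := rfl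
    simp only [S, Polynomial.map_comp, Polynomial.map_mul, Polynomial.map_X, Polynomial.map_C,
      Polynomial.map_map,
      Polynomial.eval_comp, Polynomial.eval_mul, Polynomial.eval_C, Polynomial.eval_X, hc, hτ]
    rw [map_mul, Units.val_mul, mul_comm] at h
    exact h
  let Q (g : Γ) : A[X] := Polynomial.C (P.coeff i) * S g - Polynomial.C ((S g).coeff i) * P
  have hQcoeff (g : Γ) (k : ℕ) :
      (Q g).coeff k = P.coeff i * (S g).coeff k - (S g).coeff i * P.coeff k := by
    simp [Q]
  have hQsupp (g : Γ) : (Q g).support ⊆ P.support.erase i := by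
    intro k hk
    rw [Polynomial.mem_support_iff, hQcoeff] at hk
    rw [Finset.mem_erase, Polynomial.mem_support_iff]
    refine ⟨fun h => hk (by rw [h]; ring), fun h => hk (by rw [hScoeff, h]; simp)⟩
  have hQ (g : Γ) : Polynomial.aeval F (Q g) = 0 := by
    have h0 : Polynomial.aeval F P = 0 := hfP
    simp [Q, hS, h0]
  by_cases hall : ∃ g, Q g ≠ 0
  · obtain ⟨g, hg⟩ := hall
    obtain ⟨e, he0, he, hmem⟩ := ih _ (hn ▸ (Finset.card_le_card (hQsupp g)).trans_lt
      (Finset.card_erase_lt_of_mem hi)) hg (hQ g) rfl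
    refine ⟨e, he0, he.trans ?_, hmem⟩
    exact Polynomial.natDegree_le_natDegree
      (Polynomial.degree_mono ((hQsupp g).trans (Finset.erase_subset _ _)))
  push Not at hall
  refine ⟨j - i, by omega, (Nat.sub_le _ _).trans (Polynomial.le_natDegree_of_mem_supp _ hj), ?_⟩
  have hai : ((P.coeff i : A) : Γ → ℂ) ≠ 0 :=
    fun h => Polynomial.mem_support_iff.mp hi (Subtype.ext h)
  have haj : ((P.coeff j : A) : Γ → ℂ) ≠ 0 :=
    fun h => Polynomial.mem_support_iff.mp hj (Subtype.ext h)
  obtain ⟨x, hx⟩ := Function.ne_iff.mp hai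
  obtain ⟨y, hy⟩ := Function.ne_iff.mp haj
  let ai : Γ → ℂ := (P.coeff i).1
  let aj : Γ → ℂ := (P.coeff j).1
  have key (g : Γ) : ai x * (aj (x * g) * (f g : ℂ) ^ j) =
      ai (x * g) * (f g : ℂ) ^ i * aj x := by
    have h := hQcoeff g j
    rw [hall g, Polynomial.coeff_zero, hScoeff, hScoeff] at h
    exact sub_eq_zero.mp (congrFun (congrArg Subtype.val h) x).symm
  refine mem_of_mul_mem hA hinv (f ^ (j - i))
    (A.smul_mem ((hinv.left x).mem (P.coeff j).2) (ai x)) (fun h => ?_) ?_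
  · have h' := congrFun h (x⁻¹ * y)
    simp only [Pi.smul_apply, mul_inv_cancel_left, smul_eq_mul, Pi.zero_apply] at h'
    exact (mul_ne_zero hx hy) h'
  · convert A.smul_mem ((hinv.left x).mem (P.coeff i).2) (aj x) using 1
    funext g
    have hfi : (f g : ℂ) ^ i ≠ 0 := pow_ne_zero _ (f g).ne_zero
    have hp : (f g : ℂ) ^ j = (f g : ℂ) ^ (j - i) * (f g : ℂ) ^ i := by
      rw [← pow_add, Nat.sub_add_cancel hij.le]
    simp only [Pi.smul_apply, smul_eq_mul, MonoidHom.pow_apply, Units.val_pow_eq_pow_val]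
    refine mul_right_cancel₀ hfi ?_
    have := key g
    rw [hp] at this
    linear_combination this

/-- A homomorphism to `ℂˣ` whose graph satisfies enough algebraic equations is regular. -/
theorem mem_of_forall_exists_aeval_eq_zero {A : Subalgebra ℂ (Γ → ℂ)} (hA : IsAffineAlgebra A)
    (hinv : IsTranslationInvariant A) (f : Γ →* ℂˣ)
    (hf : ∀ t : ℂˣ, t ≠ 1 → ∃ P : A[X], Polynomial.aeval (fun x => (f x : ℂ)) P = 0 ∧
      (P.map (evalPoint A 1 : A →+* ℂ)).eval (t : ℂ) ≠ 0) : (fun x => (f x : ℂ)) ∈ A := by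
  classical
  let F : Γ → ℂ := fun x => (f x : ℂ)
  have hex : ∃ e, 0 < e ∧ (fun x => ((f ^ e) x : ℂ)) ∈ A := by
    obtain ⟨P, hP, hP1⟩ := hf (-1) (by
      intro h
      have := congrArg Units.val h
      norm_num at this)
    obtain ⟨e, he, -, h⟩ := exists_pow_mem_of_aeval_eq_zero hA hinv f
      (fun h => hP1 (by simp [h])) hP
    exact ⟨e, he, h⟩
  obtain ⟨hd0, hd⟩ := Nat.find_spec hex
  have hmin := fun e => Nat.find_min (H := hex) (m := e)
  generalize Nat.find hex = d at hd0 hd hmin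
  rcases Nat.lt_or_ge 1 d with hd1 | hd1
  swap
  · obtain rfl : d = 1 := by omega
    simpa using hd
  exfalso
  have hprim := Complex.isPrimitiveRoot_exp d hd0.ne'
  set ζ := Complex.exp (2 * Real.pi * Complex.I / d)
  have hζ : ζ ≠ 1 := hprim.ne_one hd1
  have hζ0 : ζ ≠ 0 := hprim.ne_zero hd0.ne'
  obtain ⟨P, hP, hP1⟩ := hf (Units.mk0 ζ hζ0) fun h => hζ (congrArg Units.val h)
  let h : A := ⟨_, hd⟩
  have hmonic : (Polynomial.X ^ d - Polynomial.C h : A[X]).Monic :=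
    Polynomial.monic_X_pow_sub_C h hd0.ne'
  have hroot : Polynomial.aeval F (Polynomial.X ^ d - Polynomial.C h : A[X]) = 0 := by
    funext x
    rw [aeval_apply_eq_eval_map]
    simp [F, h]
  have hroot1 :
      ((Polynomial.X ^ d - Polynomial.C h : A[X]).map (evalPoint A 1 : A →+* ℂ)).eval ζ = 0 := by
    simp [h, hprim.pow_eq_one]
  have hdiv := Polynomial.modByMonic_add_div P (Polynomial.X ^ d - Polynomial.C h : A[X])
  have hR : Polynomial.aeval F (P %ₘ (Polynomial.X ^ d - Polynomial.C h)) = 0 := by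
    have h1 := congrArg (Polynomial.aeval F) hdiv
    rw [map_add, map_mul, hroot, zero_mul, add_zero] at h1
    exact h1.trans hP
  have hR0 : P %ₘ (Polynomial.X ^ d - Polynomial.C h) ≠ 0 := by
    intro h0
    apply hP1
    rw [← hdiv, h0, zero_add, Polynomial.map_mul, Polynomial.eval_mul]
    change (Polynomial.eval ζ _) * _ = 0
    rw [hroot1, zero_mul]
  obtain ⟨e, he0, he, hmem⟩ := exists_pow_mem_of_aeval_eq_zero hA hinv f hR0 hR
  have hlt := Polynomial.natDegree_modByMonic_lt P hmonic (fun h1 => by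
    have := congrArg Polynomial.natDegree h1
    rw [Polynomial.natDegree_X_pow_sub_C, Polynomial.natDegree_one] at this
    omega)
  rw [Polynomial.natDegree_X_pow_sub_C] at hlt
  exact hmin e (he.trans_lt hlt) ⟨he0, hmem⟩

/-- The Laurent polynomial functions on `ℂˣ`. -/
def unitsAlgebra : Subalgebra ℂ (ℂˣ → ℂ) :=
  Algebra.adjoin ℂ {fun t : ℂˣ => (t : ℂ), fun t : ℂˣ => ((t⁻¹ : ℂˣ) : ℂ)}

theorem unitsAlgebra_fg : unitsAlgebra.FG :=
  Subalgebra.fg_def.mpr ⟨_, Set.toFinite _, rfl⟩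

theorem val_mem_unitsAlgebra : (fun t : ℂˣ => (t : ℂ)) ∈ unitsAlgebra :=
  Algebra.subset_adjoin (by simp)

theorem inv_mem_unitsAlgebra : (fun t : ℂˣ => ((t⁻¹ : ℂˣ) : ℂ)) ∈ unitsAlgebra :=
  Algebra.subset_adjoin (by simp)

theorem isRegularMap_unitsAlgebra {X : Type*} {A : Subalgebra ℂ (X → ℂ)} {f : X → ℂˣ}
    (hf : (fun x => (f x : ℂ)) ∈ A) (hf' : (fun x => (((f x)⁻¹ : ℂˣ) : ℂ)) ∈ A) :
    IsRegularMap A unitsAlgebra f := by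
  refine Algebra.adjoin_le ?_
  rintro _ (rfl | rfl)
  · exact hf
  · exact hf'

theorem isTranslationInvariant_unitsAlgebra : IsTranslationInvariant unitsAlgebra where
  left g := isRegularMap_unitsAlgebra
    (by simpa using! unitsAlgebra.smul_mem val_mem_unitsAlgebra (g : ℂ))
    (by
      convert unitsAlgebra.smul_mem inv_mem_unitsAlgebra ((g⁻¹ : ℂˣ) : ℂ) using 1
      funext t
      simp [mul_comm])
  right g := isRegularMap_unitsAlgebra
    (by
      convert unitsAlgebra.smul_mem val_mem_unitsAlgebra (g : ℂ) using 1
      funext t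
      simp [mul_comm])
    (by
      convert unitsAlgebra.smul_mem inv_mem_unitsAlgebra ((g⁻¹ : ℂˣ) : ℂ) using 1
      funext t
      simp)
  inv := isRegularMap_unitsAlgebra inv_mem_unitsAlgebra (by simpa using val_mem_unitsAlgebra)

theorem IsTranslationInvariant.box {Γ' : Type*} [Group Γ'] {A : Subalgebra ℂ (Γ → ℂ)}
    {B : Subalgebra ℂ (Γ' → ℂ)} (hA : IsTranslationInvariant A)
    (hB : IsTranslationInvariant B) : IsTranslationInvariant (boxAlgebra A B) where
  left g := ((hA.left g.1).comp (isRegularMap_fst A B)).prodMk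
    ((hB.left g.2).comp (isRegularMap_snd A B))
  right g := ((hA.right g.1).comp (isRegularMap_fst A B)).prodMk
    ((hB.right g.2).comp (isRegularMap_snd A B))
  inv := (hA.inv.comp (isRegularMap_fst A B)).prodMk (hB.inv.comp (isRegularMap_snd A B))

theorem exists_polynomial_of_mem_box_unitsAlgebra {Y : Type*} {A : Subalgebra ℂ (Y → ℂ)}
    {F : Y × ℂˣ → ℂ} (hF : F ∈ boxAlgebra A unitsAlgebra) :
    ∃ (m : ℕ) (P : A[X]), ∀ (x : Y) (t : ℂˣ),
      (t : ℂ) ^ m * F (x, t) = (P.map (evalPoint A x : A →+* ℂ)).eval (t : ℂ) := by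
  let D : Subalgebra ℂ (Y × ℂˣ → ℂ) :=
    { carrier := {F | ∃ (m : ℕ) (P : A[X]), ∀ (x : Y) (t : ℂˣ),
        (t : ℂ) ^ m * F (x, t) = (P.map (evalPoint A x : A →+* ℂ)).eval (t : ℂ)}
      mul_mem' := by
        rintro F F' ⟨m, P, h⟩ ⟨m', P', h'⟩
        refine ⟨m + m', P * P', fun x t => ?_⟩
        rw [Polynomial.map_mul, Polynomial.eval_mul, ← h, ← h', Pi.mul_apply]
        ring
      add_mem' := by
        rintro F F' ⟨m, P, h⟩ ⟨m', P', h'⟩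
        refine ⟨m + m', Polynomial.X ^ m' * P + Polynomial.X ^ m * P', fun x t => ?_⟩
        simp only [Polynomial.map_add, Polynomial.map_mul, Polynomial.map_pow, Polynomial.map_X,
          Polynomial.eval_add,
          Polynomial.eval_mul, Polynomial.eval_pow, Polynomial.eval_X, ← h, ← h', Pi.add_apply]
        ring
      algebraMap_mem' := fun r => ⟨0, Polynomial.C (algebraMap ℂ A r), fun x t => by
        simp [Algebra.algebraMap_eq_smul_one]⟩ }
  have hle : boxAlgebra A unitsAlgebra ≤ D := by
    refine sup_le ?_ ?_ <;> rw [Subalgebra.map_le]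
    · exact fun a ha => ⟨0, Polynomial.C ⟨a, ha⟩, fun x t => by simp⟩
    · refine Algebra.adjoin_le ?_
      rintro _ (rfl | rfl)
      · exact ⟨0, Polynomial.X, fun x t => by simp⟩
      · exact ⟨1, 1, fun x t => by simp⟩
  exact hle hF

/-- A homomorphism to `ℂˣ` that becomes regular on an affine variety mapping onto the group is
regular. -/
theorem mem_of_surjective_of_comp_mem {A : Subalgebra ℂ (Γ → ℂ)} (hA : IsAffineAlgebra A)
    (hsep : SeparatesPts A) (hinv : IsTranslationInvariant A) {B : Subalgebra ℂ (W → ℂ)}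
    (hB : IsAffineAlgebra B) {π : W → Γ} (hπ : IsRegularMap B A π)
    (hsurj : Function.Surjective π) (f : Γ →* ℂˣ) (hf : (fun w => (f (π w) : ℂ)) ∈ B)
    (hf' : (fun w => (((f (π w))⁻¹ : ℂˣ) : ℂ)) ∈ B) : (fun x => (f x : ℂ)) ∈ A := by
  refine mem_of_forall_exists_aeval_eq_zero hA hinv f fun t ht => ?_
  have hnot : ((1 : Γ), t) ∉ f.graph := fun h => ht (by simpa using (MonoidHom.mem_graph.mp h).symm)
  have hcl := mt (mem_of_mem_closure_of_range_eq (A := boxAlgebra A unitsAlgebra)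
    ((hA.fg.map _).sup (unitsAlgebra_fg.map _)) (fun p q h => ?_)
    (hinv.box isTranslationInvariant_unitsAlgebra) hB
    (hπ.prodMk (isRegularMap_unitsAlgebra hf hf')) (C := f.graph) (x := (1, t)) ?_) hnot
  · push Not at hcl
    obtain ⟨F, hF, hF0, hF1⟩ := hcl
    obtain ⟨m, P, hP⟩ := exists_polynomial_of_mem_box_unitsAlgebra hF
    refine ⟨P, funext fun x => ?_, ?_⟩
    · rw [aeval_apply_eq_eval_map, ← hP, hF0 _ (MonoidHom.mem_graph.mpr rfl), mul_zero]
      rfl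
    · rw [← hP]
      exact mul_ne_zero (pow_ne_zero _ t.ne_zero) hF1
  · refine Prod.ext (hsep _ _ fun a ha => h _ (isRegularMap_fst A unitsAlgebra ha))
      (Units.ext (h _ (isRegularMap_snd A unitsAlgebra val_mem_unitsAlgebra)))
  · ext ⟨x, s⟩
    constructor
    · rintro ⟨w, hw⟩
      rw [← hw]
      exact MonoidHom.mem_graph.mpr rfl
    · intro h
      obtain ⟨w, rfl⟩ := hsurj x
      exact ⟨w, Prod.ext rfl (MonoidHom.mem_graph.mp h)⟩

end Characters

section ExtensionOfCharacters

theorem exists_common_eigenvector {ι E : Type*} [AddCommGroup E] [Module ℂ E]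
    (T : ι → Module.End ℂ E) (hT : ∀ i j v, T i (T j v) = T j (T i v)) (N : Submodule ℂ E)
    [FiniteDimensional ℂ N] (hN : N ≠ ⊥) (hstab : ∀ i, ∀ v ∈ N, T i v ∈ N) :
    ∃ v ∈ N, v ≠ 0 ∧ ∀ i, ∃ c : ℂ, T i v = c • v := by
  induction hn : Module.finrank ℂ N using Nat.strong_induction_on generalizing N with
  | _ n ih =>
  by_cases hscal : ∀ i, ∃ c : ℂ, ∀ v ∈ N, T i v = c • v
  · obtain ⟨v, hv, hv0⟩ := N.exists_mem_ne_zero_of_ne_bot hN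
    exact ⟨v, hv, hv0, fun i => (hscal i).imp fun c hc => hc v hv⟩
  push Not at hscal
  obtain ⟨i, hi⟩ := hscal
  have : Nontrivial N := N.nontrivial_iff_ne_bot.mpr hN
  obtain ⟨μ, hμ⟩ := Module.End.exists_eigenvalue ((T i).restrict (hstab i))
  obtain ⟨w, hw⟩ := hμ.exists_hasEigenvector
  have hwi : T i w = μ • (w : E) := congrArg Subtype.val hw.apply_eq_smul
  have hlt : N ⊓ Module.End.eigenspace (T i) μ < N := by
    refine lt_of_le_of_ne inf_le_left fun h => ?_
    obtain ⟨v, hv, hne⟩ := hi μ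
    exact hne (Module.End.mem_eigenspace_iff.mp (inf_eq_left.mp h hv))
  have : FiniteDimensional ℂ ↥(N ⊓ Module.End.eigenspace (T i) μ) :=
    Submodule.finiteDimensional_of_le inf_le_left
  obtain ⟨v, hv, hv'⟩ := ih _ (hn ▸ Submodule.finrank_lt_finrank_of_lt hlt)
    (N ⊓ Module.End.eigenspace (T i) μ)
    ((Submodule.ne_bot_iff _).mpr ⟨w, ⟨w.2, Module.End.mem_eigenspace_iff.mpr hwi⟩,
      fun h => hw.2 (Subtype.ext h)⟩)
    (fun j v hv => ⟨hstab j v hv.1, Module.End.mem_eigenspace_iff.mpr (by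
      rw [hT, Module.End.mem_eigenspace_iff.mp hv.2, map_smul])⟩) rfl
  exact ⟨v, hv.1, hv'⟩

/-- The slices of a regular function on a product span a finite-dimensional space. -/
theorem exists_fg_forall_slice_mem {X Y : Type*} {A : Subalgebra ℂ (X → ℂ)}
    {B : Subalgebra ℂ (Y → ℂ)} {F : X × Y → ℂ} (hF : F ∈ boxAlgebra A B) :
    ∃ M : Submodule ℂ (X → ℂ), M.FG ∧ ∀ y, (fun x => F (x, y)) ∈ M := by
  let D : Subalgebra ℂ (X × Y → ℂ) :=
    { carrier := {F | ∃ M : Submodule ℂ (X → ℂ), M.FG ∧ ∀ y, (fun x => F (x, y)) ∈ M}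
      mul_mem' := by
        rintro F F' ⟨M, hM, h⟩ ⟨M', hM', h'⟩
        exact ⟨M * M', hM.mul hM', fun y => Submodule.mul_mem_mul (h y) (h' y)⟩
      add_mem' := by
        rintro F F' ⟨M, hM, h⟩ ⟨M', hM', h'⟩
        exact ⟨M ⊔ M', hM.sup hM', fun y => Submodule.add_mem_sup (h y) (h' y)⟩
      algebraMap_mem' := fun r => ⟨ℂ ∙ 1, Submodule.fg_span_singleton _, fun _ =>
        Submodule.mem_span_singleton.mpr ⟨r, by
          funext x
          simp⟩⟩ }
  have hle : boxAlgebra A B ≤ D := by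
    refine sup_le ?_ ?_ <;> rw [Subalgebra.map_le]
    · exact fun a _ => ⟨ℂ ∙ a, Submodule.fg_span_singleton _, fun _ =>
        Submodule.mem_span_singleton_self a⟩
    · exact fun b _ => ⟨ℂ ∙ 1, Submodule.fg_span_singleton _, fun y =>
        Submodule.mem_span_singleton.mpr ⟨b y, by
          funext x
          simp⟩⟩
  exact hle hF

/-- Characters of finite subgroups of commutative algebraic groups extend. -/
theorem exists_regular_character_extending {Z : Type*} [Group Z]
    (hcomm : ∀ x y : Z, x * y = y * x) {A : Subalgebra ℂ (Z → ℂ)} (hsep : SeparatesPts A)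
    (hinv : IsTranslationInvariant A)
    (hmul : IsRegularMap (boxAlgebra A A) A (fun p => p.1 * p.2)) (F : Subgroup Z) [Finite F]
    (γ : F →* ℂˣ) :
    ∃ α : Z →* ℂˣ, (fun z => (α z : ℂ)) ∈ A ∧ ∀ f : F, α f = γ f := by
  have := Fintype.ofFinite F
  let T (g : Z) : Module.End ℂ (Z → ℂ) := (pullbackFun (fun x => x * g)).toLinearMap
  have hTapp (g : Z) (a : Z → ℂ) (x : Z) : T g a x = a (x * g) := rfl
  let V : Submodule ℂ (Z → ℂ) :=
    { carrier := {a | a ∈ A ∧ ∀ (f : F) (x : Z), a (x * f) = γ f * a x}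
      add_mem' := fun {a b} ha hb => ⟨A.add_mem ha.1 hb.1, fun f x => by
        simp only [Pi.add_apply, ha.2, hb.2, mul_add]⟩
      zero_mem' := ⟨A.zero_mem, by simp⟩
      smul_mem' := fun c a ha => ⟨A.smul_mem ha.1 c, fun f x => by
        simp only [Pi.smul_apply, ha.2, smul_eq_mul]
        ring⟩ }
  have hVT : ∀ g, ∀ a ∈ V, T g a ∈ V := fun g a ha => ⟨(hinv.right g).mem ha.1, fun f x => by
    rw [hTapp, hTapp, mul_assoc, hcomm f g, ← mul_assoc, ha.2]⟩
  obtain ⟨a, ha, ha0⟩ : ∃ a ∈ V, a ≠ 0 := by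
    have hli : LinearIndependent ℂ
        (fun f : F => ((evalPoint A (f : Z) : A →* ℂ) : A → ℂ)) := by
      refine (linearIndependent_monoidHom A ℂ).comp (fun f : F => (evalPoint A (f : Z) : A →* ℂ))
        fun f f' h => Subtype.ext (hsep _ _ fun a ha => ?_)
      exact DFunLike.congr_fun h (⟨a, ha⟩ : A)
    obtain ⟨a, hne⟩ : ∃ a : A, ∑ f : F, ((γ f)⁻¹ : ℂˣ).1 * (a : Z → ℂ) f ≠ 0 := by
      by_contra! h
      refine (γ 1)⁻¹.ne_zero (Fintype.linearIndependent_iff.mp hli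
        (fun f => ((γ f)⁻¹ : ℂˣ).1) (funext fun a => ?_) 1)
      simpa using h a
    refine ⟨fun x => ∑ f : F, ((γ f)⁻¹ : ℂˣ).1 * (a : Z → ℂ) (x * f), ⟨?_, fun h x => ?_⟩,
      fun h => hne ?_⟩
    · have := A.sum_mem (t := Finset.univ) fun (f : F) _ =>
        A.smul_mem ((hinv.right (f : Z)).mem a.2) ((γ f)⁻¹ : ℂˣ).1
      convert this using 1
      funext x
      simp
    · rw [Finset.mul_sum]
      refine Fintype.sum_equiv (Equiv.mulLeft h) _ _ fun f => ?_
      simp only [Equiv.coe_mulLeft, map_mul, mul_inv, Units.val_mul, Subgroup.coe_mul,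
        ← mul_assoc, Units.mul_inv, one_mul]
    · simpa using congrFun h 1
  obtain ⟨M, hM, hMa⟩ := exists_fg_forall_slice_mem (hmul.mem ha.1)
  let N : Submodule ℂ (Z → ℂ) := Submodule.span ℂ (Set.range fun g => T g a)
  have hNM : N ≤ M := Submodule.span_le.mpr (by rintro _ ⟨g, rfl⟩; exact hMa g)
  have hNV : N ≤ V := Submodule.span_le.mpr (by rintro _ ⟨g, rfl⟩; exact hVT g a ha)
  have : FiniteDimensional ℂ M := Module.Finite.iff_fg.mpr hM
  have : FiniteDimensional ℂ N := Submodule.finiteDimensional_of_le hNM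
  have haN : a ∈ N := Submodule.subset_span ⟨1, funext fun x => by simp [hTapp]⟩
  have hNT : ∀ g, ∀ v ∈ N, T g v ∈ N := by
    intro g
    change N ≤ N.comap (T g)
    refine Submodule.span_le.mpr ?_
    rintro _ ⟨h, rfl⟩
    exact Submodule.subset_span ⟨g * h, funext fun x => by simp [hTapp, mul_assoc]⟩
  obtain ⟨v, hvN, hv0, hv⟩ := exists_common_eigenvector T
    (fun g h v => funext fun x => by simp only [hTapp, mul_assoc, hcomm g h]) N
    ((Submodule.ne_bot_iff _).mpr ⟨a, haN, ha0⟩) hNT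
  have hv' (g x : Z) : v 1 * v (x * g) = v g * v x := by
    obtain ⟨c, hc⟩ := hv g
    have h1 := congrFun hc 1
    have h2 := congrFun hc x
    simp only [hTapp, one_mul, Pi.smul_apply, smul_eq_mul] at h1 h2
    rw [h1, h2]
    ring
  have hv1 : v 1 ≠ 0 := by
    intro h
    obtain ⟨x, hx⟩ := Function.ne_iff.mp hv0
    have := hv' x x
    rw [h, zero_mul] at this
    exact (mul_ne_zero hx hx) this.symm
  let β : Z →* ℂ :=
    { toFun := fun z => (v 1)⁻¹ * v z
      map_one' := inv_mul_cancel₀ hv1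
      map_mul' := fun x y => by
        have := hv' y x
        field_simp
        linear_combination this }
  refine ⟨β.toHomUnits, A.smul_mem (hNV hvN).1 (v 1)⁻¹, fun f => Units.ext ?_⟩
  change (v 1)⁻¹ * v f = γ f
  have := (hNV hvN).2 f 1
  rw [one_mul] at this
  rw [this]
  field_simp

end ExtensionOfCharacters

namespace AffAlgGroup

/-- The coordinate algebra of an affine algebraic group. -/
def regAlg (G : AffAlgGroup) : Subalgebra ℂ (G.Gp → ℂ) :=
  (aeval (fun i (x : G.Gp) => x.1 i) : MvPolynomial (Fin G.n) ℂ →ₐ[ℂ] (G.Gp → ℂ)).range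

theorem aeval_coord_apply {X : Type*} {σ : Type*} (c : σ → X → ℂ) (P : MvPolynomial σ ℂ) (x : X) :
    (aeval c P : X → ℂ) x = eval (fun i => c i x) P := by
  have h : (Pi.evalAlgHom ℂ (fun _ : X => ℂ) x).comp (aeval c) = aeval (fun i => c i x) :=
    MvPolynomial.algHom_ext fun i => by simp
  simpa [MvPolynomial.coe_aeval_eq_eval] using DFunLike.congr_fun h P

theorem mem_regAlg {G : AffAlgGroup} {a : G.Gp → ℂ} :
    a ∈ G.regAlg ↔ ∃ P : MvPolynomial (Fin G.n) ℂ, ∀ x : G.Gp, a x = eval x.1 P := by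
  constructor
  · rintro ⟨P, rfl⟩
    exact ⟨P, fun x => aeval_coord_apply _ P x⟩
  · rintro ⟨P, hP⟩
    have h : aeval (fun i (x : G.Gp) => x.1 i) P = a := by
      funext x
      rw [aeval_coord_apply, hP]
    exact h ▸ AlgHom.mem_range_self _ P

theorem eval_mem_of_forall_mem {X σ : Type*} {A : Subalgebra ℂ (X → ℂ)} {c : σ → X → ℂ}
    (hc : ∀ i, c i ∈ A) (P : MvPolynomial σ ℂ) : (fun x => eval (fun i => c i x) P) ∈ A := by
  have h : aeval c P ∈ (aeval c : MvPolynomial σ ℂ →ₐ[ℂ] (X → ℂ)).range := ⟨P, rfl⟩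
  rw [← Algebra.adjoin_range_eq_range_aeval] at h
  have h' := Algebra.adjoin_le (Set.range_subset_iff.mpr hc) h
  rwa [funext (aeval_coord_apply c P)] at h'

theorem coord_mem_regAlg (G : AffAlgGroup) (i : Fin G.n) : (fun x : G.Gp => x.1 i) ∈ G.regAlg :=
  mem_regAlg.mpr ⟨X i, fun x => by simp⟩

/-- A map into an algebraic group with regular coordinates is regular. -/
theorem isRegularMap_of_coord {W : Type*} {A : Subalgebra ℂ (W → ℂ)} {H : AffAlgGroup}
    {f : W → H.Gp} (hf : ∀ i, (fun w => (f w).1 i) ∈ A) : IsRegularMap A H.regAlg f := by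
  intro b hb
  obtain ⟨P, hP⟩ := mem_regAlg.mp hb
  have h : pullbackFun f b = fun w => eval (fun i => (f w).1 i) P := funext fun w => hP (f w)
  change pullbackFun f b ∈ A
  rw [h]
  exact eval_mem_of_forall_mem hf P

theorem separatesPts_regAlg (G : AffAlgGroup) : SeparatesPts G.regAlg :=
  fun _ _ h => Subtype.ext (funext fun i => h _ (G.coord_mem_regAlg i))

theorem isAffineAlgebra_regAlg (G : AffAlgGroup) : IsAffineAlgebra G.regAlg where
  fg := by
    have := (Algebra.FiniteType.out : (⊤ : Subalgebra ℂ (MvPolynomial (Fin G.n) ℂ)).FG).map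
      (aeval (fun i (x : G.Gp) => x.1 i) : MvPolynomial (Fin G.n) ℂ →ₐ[ℂ] (G.Gp → ℂ))
    rwa [Algebra.map_top] at this
  exists_eq_eval e := by
    let φ : MvPolynomial (Fin G.n) ℂ →ₐ[ℂ] G.regAlg :=
      (aeval (fun i (x : G.Gp) => x.1 i) : MvPolynomial (Fin G.n) ℂ →ₐ[ℂ] (G.Gp → ℂ)).rangeRestrict
    have hφ : ∀ P x, (φ P : G.Gp → ℂ) x = eval x.1 P := fun P x => aeval_coord_apply _ P x
    let p : Pt G.n := fun i => e (φ (X i))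
    have he : ∀ P, e (φ P) = eval p P := by
      intro P
      have h : e.comp φ = aeval p := MvPolynomial.algHom_ext fun i => by simp [p]
      simpa [MvPolynomial.coe_aeval_eq_eval] using DFunLike.congr_fun h P
    have hp : p ∈ G.carrier := by
      obtain ⟨S, hS⟩ := G.isAlgebraic
      rw [hS]
      intro P hP
      have h0 : φ P = 0 := Subtype.ext <| funext fun x => by
        rw [hφ]
        exact (hS.subset x.2) P hP
      rw [← he, h0, map_zero]
    refine ⟨⟨p, hp⟩, AlgHom.ext fun ⟨a, P, hP⟩ => ?_⟩
    have h : (⟨a, P, hP⟩ : G.regAlg) = φ P := Subtype.ext hP.symm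
    rw [h, he]
    exact (hφ P ⟨p, hp⟩).symm

theorem isRegularMap_mul (G : AffAlgGroup) :
    IsRegularMap (boxAlgebra G.regAlg G.regAlg) G.regAlg (fun p => p.1 * p.2) := by
  refine isRegularMap_of_coord fun i => ?_
  obtain ⟨P, hP⟩ := G.mul_regular
  have h : (fun p : G.Gp × G.Gp => (p.1 * p.2).1 i) = fun p =>
      eval (fun j => (Fin.append (fun k (p : G.Gp × G.Gp) => p.1.1 k) (fun k p => p.2.1 k)) j p)
        (P i) := by
    funext p
    have hz : (fun j => (Fin.append (fun k (p : G.Gp × G.Gp) => p.1.1 k) (fun k p => p.2.1 k)) j p)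
        = Fin.append p.1.1 p.2.1 := by
      funext j
      induction j using Fin.addCases <;> simp only [Fin.append_left, Fin.append_right]
    have hl : Pt.left (Fin.append p.1.1 p.2.1) = p.1.1 :=
      funext fun j => Fin.append_left _ _ j
    have hr : Pt.right (Fin.append p.1.1 p.2.1) = p.2.1 :=
      funext fun j => Fin.append_right _ _ j
    rw [hz]
    refine Eq.trans ?_ (hP (Fin.append p.1.1 p.2.1)
      ⟨by rw [hl]; exact p.1.2, by rw [hr]; exact p.2.2⟩ i)
    dsimp only
    rw [hl, hr]
    rfl
  rw [h]
  refine eval_mem_of_forall_mem (fun j => ?_) _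
  induction j using Fin.addCases with
  | left j =>
    rw [Fin.append_left]
    exact (isRegularMap_fst G.regAlg G.regAlg).mem (G.coord_mem_regAlg j)
  | right j =>
    rw [Fin.append_right]
    exact (isRegularMap_snd G.regAlg G.regAlg).mem (G.coord_mem_regAlg j)

theorem isRegularMap_inv (G : AffAlgGroup) : IsRegularMap G.regAlg G.regAlg (fun x => x⁻¹) := by
  obtain ⟨P, hP⟩ := G.inv_regular
  refine isRegularMap_of_coord fun i => mem_regAlg.mpr ⟨P i, fun x => ?_⟩
  exact hP x.1 x.2 i

theorem isRegularMap_mul_left (G : AffAlgGroup) (g : G.Gp) :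
    IsRegularMap G.regAlg G.regAlg (fun x => g * x) := by
  have h : IsRegularMap G.regAlg (boxAlgebra G.regAlg G.regAlg) (fun x => (g, x)) :=
    IsRegularMap.prodMk (isRegularMap_const G.regAlg G.regAlg g) (isRegularMap_id G.regAlg)
  exact (G.isRegularMap_mul.comp h :)

theorem isRegularMap_mul_right (G : AffAlgGroup) (g : G.Gp) :
    IsRegularMap G.regAlg G.regAlg (fun x => x * g) := by
  have h : IsRegularMap G.regAlg (boxAlgebra G.regAlg G.regAlg) (fun x => (x, g)) :=
    IsRegularMap.prodMk (isRegularMap_id G.regAlg) (isRegularMap_const G.regAlg G.regAlg g)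
  exact (G.isRegularMap_mul.comp h :)

theorem isTranslationInvariant_regAlg (G : AffAlgGroup) : IsTranslationInvariant G.regAlg where
  left := G.isRegularMap_mul_left
  right := G.isRegularMap_mul_right
  inv := G.isRegularMap_inv

end AffAlgGroup

theorem AlgGroupHom.isRegularMap {G H : AffAlgGroup} (f : AlgGroupHom G H) :
    IsRegularMap G.regAlg H.regAlg f.toGpHom :=
  AffAlgGroup.isRegularMap_of_coord fun i => by
    obtain ⟨P, hP⟩ := f.regular
    exact AffAlgGroup.mem_regAlg.mpr ⟨P i, fun x => hP x.1 x.2 i⟩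

theorem AlgSubgroup.isRegularMap_incl {G : AffAlgGroup} (K : AlgSubgroup G) :
    IsRegularMap K.toGrp.regAlg G.regAlg K.incl :=
  AffAlgGroup.isRegularMap_of_coord fun i => K.toGrp.coord_mem_regAlg i

/-- A regular homomorphism of point groups comes from a morphism of algebraic groups. -/
theorem exists_algGroupHom_of_isRegularMap {G H : AffAlgGroup} (f : G.Gp →* H.Gp)
    (hf : IsRegularMap G.regAlg H.regAlg f) :
    ∃ d : AlgGroupHom G H, ∀ x : G.Gp, d.toFun x.1 = (f x).1 := by
  have hP : ∀ i, ∃ P : MvPolynomial (Fin G.n) ℂ, ∀ x : G.Gp, (f x).1 i = eval x.1 P := fun i =>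
    AffAlgGroup.mem_regAlg.mp (hf.mem (H.coord_mem_regAlg i))
  choose P hP using hP
  have hfun : ∀ x : G.Gp, (fun i => eval x.1 (P i)) = (f x).1 := fun x =>
    funext fun i => (hP i x).symm
  refine ⟨⟨fun x i => eval x (P i), fun {x} hx => ?_, fun {x y} hx hy => ?_,
    ⟨P, fun _ _ _ => rfl⟩⟩, hfun⟩
  · exact (hfun ⟨x, hx⟩).symm ▸ (f ⟨x, hx⟩).2
  · have h := congrArg Subtype.val (map_mul f ⟨x, hx⟩ ⟨y, hy⟩)
    have h' := congrArg₂ H.mul (hfun ⟨x, hx⟩) (hfun ⟨y, hy⟩)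
    have h'' := hfun (HMul.hMul (α := G.Gp) (β := G.Gp) ⟨x, hx⟩ ⟨y, hy⟩)
    exact h''.trans (h.trans h'.symm)

namespace AffAlgGroup

/-- A torus is isomorphic to `(ℂˣ)^k`, with regular functions the Laurent polynomials. -/
theorem IsTorus.exists_mulEquiv {H : AffAlgGroup} (hH : H.IsTorus) :
    ∃ (k : ℕ) (Φ : (Fin k → ℂˣ) ≃* H.Gp),
      (∀ (W : Type) (A : Subalgebra ℂ (W → ℂ)) (f : W → Fin k → ℂˣ),
        (∀ j, (fun w => (f w j : ℂ)) ∈ A) → (∀ j, (fun w => (((f w j)⁻¹ : ℂˣ) : ℂ)) ∈ A) →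
        IsRegularMap A H.regAlg (fun w => Φ (f w))) ∧
      ∀ j, (fun x => (Φ.symm x j : ℂ)) ∈ H.regAlg := by
  obtain ⟨k, φ, hmem, hinj, hsurj, -, hmul, hP, hQ⟩ := hH
  let Φ₀ : (Fin k → ℂˣ) →* H.Gp := MonoidHom.mk' (fun u => (⟨φ u, hmem u⟩ : H.Gp))
    fun u v => Subtype.ext (hmul u v)
  have hbij : Function.Bijective Φ₀ := by
    refine ⟨fun u v h => hinj (congrArg Subtype.val h), fun x => ?_⟩
    obtain ⟨u, hu⟩ := hsurj x.1 x.2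
    exact ⟨u, Subtype.ext hu⟩
  let Φ := MulEquiv.ofBijective Φ₀ hbij
  have hΦ : ∀ u, (Φ u).1 = φ u := fun _ => rfl
  refine ⟨k, Φ, fun W A f hf hf' => isRegularMap_of_coord fun i => ?_, fun j => ?_⟩
  · obtain ⟨P, hP⟩ := hP i
    have h : (fun w => (Φ (f w)).1 i) = fun w => eval (fun m => (Sum.elim
        (fun j w => (f w j : ℂ)) (fun j w => (((f w j)⁻¹ : ℂˣ) : ℂ)) : _ → W → ℂ) m w) P := by
      funext w
      rw [hΦ, hP]
      congr 2
      funext m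
      cases m <;> rfl
    rw [h]
    refine eval_mem_of_forall_mem (fun m => ?_) P
    cases m
    · exact hf _
    · exact hf' _
  · obtain ⟨Q, hQ⟩ := hQ j
    refine mem_regAlg.mpr ⟨Q, fun x => ?_⟩
    obtain ⟨u, rfl⟩ := Φ.surjective x
    rw [MulEquiv.symm_apply_apply]
    exact hQ u

/-- A regular character of finite order of a connected algebraic group is trivial. -/
theorem IsConnected.character_eq_one {H : AffAlgGroup} (hH : H.IsConnected) (χ : H.Gp →* ℂˣ)
    (hχ : (fun x => (χ x : ℂ)) ∈ H.regAlg) {N : ℕ} (hN : N ≠ 0) (hpow : ∀ x, χ x ^ N = 1)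
    (x : H.Gp) : χ x = 1 := by
  obtain ⟨P, hP⟩ := mem_regAlg.mp hχ
  have hsum : ∀ y : H.Gp, eval y.1 (∑ i ∈ Finset.range N, P ^ i) =
      ∑ i ∈ Finset.range N, (χ y : ℂ) ^ i := fun y => by
    simp only [map_sum, map_pow, hP]
  have hone : ∑ i ∈ Finset.range N, (1 : ℂ) ^ i ≠ 0 := by simpa using hN
  have hcover : H.carrier ⊆
      {y | eval y (P - 1) = 0} ∪ {y | eval y (∑ i ∈ Finset.range N, P ^ i) = 0} := by
    intro y hy
    have hgeom := geom_sum_mul (χ ⟨y, hy⟩ : ℂ) N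
    have hpow' : (χ ⟨y, hy⟩ : ℂ) ^ N = 1 :=
      (Units.val_pow_eq_pow_val _ _).symm.trans (congrArg Units.val (hpow ⟨y, hy⟩))
    rw [hpow', sub_self] at hgeom
    rcases mul_eq_zero.mp hgeom with h | h
    · exact Or.inr ((hsum ⟨y, hy⟩).trans h)
    · left
      change eval y (P - 1) = 0
      rw [map_sub, map_one, ← h]
      exact congrArg (· - 1) (hP ⟨y, hy⟩).symm
  have hdisj : H.carrier ∩
      ({y | eval y (P - 1) = 0} ∩ {y | eval y (∑ i ∈ Finset.range N, P ^ i) = 0}) = ∅ := by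
    refine Set.eq_empty_of_forall_notMem fun y ⟨hy, hV, hW⟩ => hone ?_
    have hχy : (χ ⟨y, hy⟩ : ℂ) = 1 := by
      have hV' : eval y (P - 1) = 0 := hV
      rw [map_sub, map_one, sub_eq_zero] at hV'
      exact (hP ⟨y, hy⟩).trans hV'
    have h := hsum ⟨y, hy⟩
    rw [hχy] at h
    exact h.symm.trans hW
  rcases hH _ _ ⟨{P - 1}, by simp⟩ ⟨{∑ i ∈ Finset.range N, P ^ i}, by simp⟩ hcover hdisj with
    h | h
  · have hx : eval x.1 (P - 1) = 0 := h x.2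
    rw [map_sub, ← hP, map_one, sub_eq_zero] at hx
    exact Units.ext hx
  · have h1 : eval (1 : H.Gp).1 (∑ i ∈ Finset.range N, P ^ i) = 0 := h (1 : H.Gp).2
    rw [hsum, map_one, Units.val_one] at h1
    exact absurd h1 hone

/-- A Zariski closed subgroup of the point group underlies an algebraic subgroup. -/
theorem exists_algSubgroup {G : AffAlgGroup} (C : Subgroup G.Gp)
    (hC : ∀ x, (∀ a ∈ G.regAlg, (∀ c ∈ C, a c = 0) → a x = 0) → x ∈ C) :
    ∃ K : AlgSubgroup G, ∀ x : G.Gp, x.1 ∈ K.carrier ↔ x ∈ C := by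
  have hiff : ∀ x : G.Gp, x.1 ∈ ((fun c : G.Gp => c.1) '' (C : Set G.Gp)) ↔ x ∈ C := fun x =>
    ⟨fun ⟨_, hc, h⟩ => (Subtype.ext h : _ = x) ▸ hc, fun hx => ⟨x, hx, rfl⟩⟩
  refine ⟨⟨(fun c : G.Gp => c.1) '' (C : Set G.Gp), ?_, ?_, ?_, ?_, ?_⟩, hiff⟩
  · rintro _ ⟨c, -, rfl⟩
    exact c.2
  · refine ⟨{P | ∀ c ∈ C, eval c.1 P = 0}, Set.Subset.antisymm ?_ fun x hx => ?_⟩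
    · rintro _ ⟨c, hc, rfl⟩ P hP
      exact hP c hc
    · have hxG : x ∈ G.carrier := by
        obtain ⟨S, hS⟩ := G.isAlgebraic
        rw [hS]
        exact fun P hP => hx P fun c _ => (hS.subset c.2) P hP
      refine (hiff ⟨x, hxG⟩).mpr (hC _ fun a ha haC => ?_)
      obtain ⟨P, hP⟩ := mem_regAlg.mp ha
      exact (hP ⟨x, hxG⟩).trans (hx P fun c hc => (hP c).symm.trans (haC c hc))
  · exact ⟨1, C.one_mem, rfl⟩
  · rintro _ _ ⟨c, hc, rfl⟩ ⟨c', hc', rfl⟩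
    exact ⟨c * c', C.mul_mem hc hc', rfl⟩
  · rintro _ ⟨c, hc, rfl⟩
    exact ⟨c⁻¹, C.inv_mem hc, rfl⟩

end AffAlgGroup

theorem commutator_mul_eq_of_commute {Γ : Type*} [Group Γ] {s s' z z' : Γ}
    (h : Commute z (s' * z')) (h' : Commute z' s) :
    (s * z) * ((s' * z') * ((s * z)⁻¹ * (s' * z')⁻¹)) = s * (s' * (s⁻¹ * s'⁻¹)) := by
  calc _ = s * (z * (s' * z')) * z⁻¹ * s⁻¹ * (s' * z')⁻¹ := by group
    _ = s * s' * (z' * s⁻¹) * z'⁻¹ * s'⁻¹ := by rw [h.eq]; group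
    _ = _ := by rw [h'.inv_right.eq]; group

/-- The projection of `U ⋊ (Z × S)` onto the factor `Z`. -/
theorem exists_projection {Γ Z : Type*} [Group Γ] [Group Z] (i : Z →* Γ)
    (hi : Function.Injective i) (U S : Subgroup Γ) [U.Normal]
    (hcomm : ∀ z, ∀ s ∈ S, i z * s = s * i z) (hZS : ∀ z, i z ∈ S → i z = 1)
    (hU : ∀ z, ∀ s ∈ S, i z * s ∈ U → i z * s = 1)
    (hdecomp : ∀ x, ∃ u ∈ U, ∃ z, ∃ s ∈ S, x = u * (i z * s)) :
    ∃ p : Γ →* Z, ∀ u ∈ U, ∀ z, ∀ s ∈ S, p (u * (i z * s)) = z := by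
  choose u hu z s hs hx using hdecomp
  have huniq : ∀ x, ∀ v ∈ U, ∀ w, ∀ t ∈ S, x = v * (i w * t) → z x = w := by
    intro x v hv w t ht h
    have h1 : i (w * (z x)⁻¹) * (t * (s x)⁻¹) = v⁻¹ * u x := by
      have h2 : v⁻¹ * (u x * (i (z x) * s x)) = i w * t := by rw [← hx, h]; group
      have h3 : v⁻¹ * u x = i w * t * (i (z x) * s x)⁻¹ := by rw [← h2]; group
      have h4 := (hcomm (z x)⁻¹ _ (S.mul_mem ht (S.inv_mem (hs x))))
      rw [h3, map_mul, mul_assoc, h4, map_inv]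
      group
    have h5 := hU _ _ (S.mul_mem ht (S.inv_mem (hs x)))
      (h1 ▸ U.mul_mem (U.inv_mem hv) (hu x))
    have h6 := hZS (w * (z x)⁻¹)
      (eq_inv_of_mul_eq_one_left h5 ▸ S.inv_mem (S.mul_mem ht (S.inv_mem (hs x))))
    rw [← map_one i] at h6
    exact (mul_inv_eq_one.mp (hi h6)).symm
  refine ⟨MonoidHom.mk' z fun x y => ?_, fun v hv w t ht => huniq _ v hv w t ht rfl⟩
  refine huniq (x * y) (u x * (i (z x) * s x * u y * (i (z x) * s x)⁻¹))
    (U.mul_mem (hu x) (‹U.Normal›.conj_mem _ (hu y) _)) _ (s x * s y)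
    (S.mul_mem (hs x) (hs y)) ?_
  have h7 := hcomm (z y) _ (hs x)
  calc x * y = u x * (i (z x) * s x) * (u y * (i (z y) * s y)) := by rw [← hx, ← hx]
    _ = u x * (i (z x) * s x * u y * (i (z x) * s x)⁻¹) * (i (z x) * (s x * i (z y)) * s y) := by
      group
    _ = _ := by rw [← h7, map_mul]; group

namespace CoveringData

variable {G : AffAlgGroup} {LD : LeviDecomposition G} (CD : CoveringData G LD)

instance finite_PiG : Finite CD.PiG :=
  Set.Finite.to_subtype (s := (CD.PiG : Set CD.Gt.Gp))
    ((CD.ker_finite.preimage Subtype.val_injective.injOn).subset fun x hx =>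
      ⟨x.2, congrArg Subtype.val hx⟩)

theorem Zc_incl_injective : Function.Injective CD.Zc.incl :=
  fun _ _ h => Subtype.ext (congrArg (fun t : CD.Gt.Gp => t.1) h)

theorem exists_eq_mul (x : CD.Gt.Gp) :
    ∃ u ∈ CD.Gu'.toSubgroup, ∃ z, ∃ s ∈ CD.Gs.toSubgroup, x = u * (CD.Zc.incl z * s) := by
  obtain ⟨u, hu, z, hz, s, hs, h⟩ := CD.decomp x.1 x.2
  exact ⟨⟨u, CD.Gu'.subset hu⟩, hu, ⟨z, hz⟩, ⟨s, CD.Gs.subset hs⟩, hs, Subtype.ext h⟩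

theorem commute_Zc_Gs (z : CD.Zc.toGrp.Gp) {s : CD.Gt.Gp} (hs : s ∈ CD.Gs.toSubgroup) :
    CD.Zc.incl z * s = s * CD.Zc.incl z :=
  Subtype.ext (CD.Zc_Gs_comm z.1 z.2 s.1 hs)

theorem toGpHom_Gu'_mem {u : CD.Gt.Gp} (hu : u ∈ CD.Gu'.toSubgroup) :
    CD.qG.toGpHom u ∈ LD.Gu.toSubgroup :=
  CD.qG_Gu'_img.subset ⟨u.1, hu, rfl⟩

theorem toGpHom_Zc_mem (z : CD.Zc.toGrp.Gp) : CD.qG.toGpHom (CD.Zc.incl z) ∈ CD.Z.toSubgroup :=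
  CD.qG_Zc_img.subset ⟨z.1, z.2, rfl⟩

theorem toGpHom_Gs_mem {s : CD.Gt.Gp} (hs : s ∈ CD.Gs.toSubgroup) :
    CD.qG.toGpHom s ∈ CD.Lder.toSubgroup :=
  CD.qG_Gs_img.subset ⟨s.1, hs, rfl⟩

theorem Z_le : CD.Z.toSubgroup ≤ LD.L.toSubgroup := fun _ hx => CD.Z_sub hx

theorem Lder_le : CD.Lder.toSubgroup ≤ LD.L.toSubgroup := fun _ hx => CD.Lder_sub hx

theorem commute_Z {z l : G.Gp} (hz : z ∈ CD.Z.toSubgroup) (hl : l ∈ LD.L.toSubgroup) :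
    Commute z l :=
  Subtype.ext (CD.Z_central z.1 hz l.1 hl)

theorem eq_one_of_mem_Gu_of_mem_L {x : G.Gp} (hu : x ∈ LD.Gu.toSubgroup)
    (hl : x ∈ LD.L.toSubgroup) : x = 1 :=
  Subtype.ext (LD.inter.subset ⟨hu, hl⟩)

theorem mul_comm_Zc (z z' : CD.Zc.toGrp.Gp) : z * z' = z' * z := by
  have h : CD.qG.toGpHom (CD.Zc.incl (z * z')) = CD.qG.toGpHom (CD.Zc.incl (z' * z)) := by
    simp only [map_mul]
    exact CD.commute_Z (CD.toGpHom_Zc_mem z) (CD.Z_le (CD.toGpHom_Zc_mem z'))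
  exact Subtype.ext (CD.qG_Zc_inj (z * z').2 (z' * z).2 (congrArg Subtype.val h))

/-- If the image of `u * (z * s)` lies in the Levi subgroup, then `u` has trivial image. -/
theorem eq_one_of_toGpHom_mem {u s : CD.Gt.Gp} (hu : u ∈ CD.Gu'.toSubgroup)
    (z : CD.Zc.toGrp.Gp) (hs : s ∈ CD.Gs.toSubgroup)
    (h : CD.qG.toGpHom (u * (CD.Zc.incl z * s)) ∈ LD.L.toSubgroup) : u = 1 := by
  have hzs : CD.qG.toGpHom (CD.Zc.incl z * s) ∈ LD.L.toSubgroup := by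
    rw [map_mul]
    exact mul_mem (CD.Z_le (CD.toGpHom_Zc_mem z)) (CD.Lder_le (CD.toGpHom_Gs_mem hs))
  rw [map_mul, Subgroup.mul_mem_cancel_right _ hzs] at h
  have h1 := eq_one_of_mem_Gu_of_mem_L (CD.toGpHom_Gu'_mem hu) h
  rw [← map_one CD.qG.toGpHom] at h1
  exact Subtype.ext (CD.qG_Gu'_inj hu CD.Gu'.one_mem (congrArg Subtype.val h1))

/-- Commutators of the Levi subgroup are images of commutators of `G̃'_red`. -/
theorem exists_commutator_eq {l l' : G.Gp} (hl : l ∈ LD.L.toSubgroup)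
    (hl' : l' ∈ LD.L.toSubgroup) : ∃ s s' : CD.Gs.toGrp.Gp,
      l * (l' * (l⁻¹ * l'⁻¹)) = CD.qG.toGpHom (CD.Gs.incl (s * (s' * (s⁻¹ * s'⁻¹)))) := by
  have hlift : ∀ l ∈ LD.L.toSubgroup, ∃ (s : CD.Gs.toGrp.Gp) (z : CD.Zc.toGrp.Gp),
      l = CD.qG.toGpHom (CD.Gs.incl s) * CD.qG.toGpHom (CD.Zc.incl z) := by
    intro l hl
    obtain ⟨x, hx, hxl⟩ := CD.qG_surj l.1 l.2
    obtain ⟨u, hu, z, s, hs, h⟩ := CD.exists_eq_mul ⟨x, hx⟩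
    have hxl' : l = CD.qG.toGpHom (u * (CD.Zc.incl z * s)) :=
      h ▸ (Subtype.ext hxl : CD.qG.toGpHom ⟨x, hx⟩ = l).symm
    have hu1 := CD.eq_one_of_toGpHom_mem hu z hs (hxl' ▸ hl)
    refine ⟨⟨s.1, hs⟩, z, ?_⟩
    rw [hxl', hu1, one_mul, CD.commute_Zc_Gs z hs, map_mul]
    rfl
  obtain ⟨s, z, rfl⟩ := hlift l hl
  obtain ⟨s', z', rfl⟩ := hlift l' hl'
  refine ⟨s, s', ?_⟩
  rw [commutator_mul_eq_of_commute (CD.commute_Z (CD.toGpHom_Zc_mem z) hl')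
    (CD.commute_Z (CD.toGpHom_Zc_mem z') (CD.Lder_le (CD.toGpHom_Gs_mem s.2)))]
  simp only [map_mul, map_inv]

/-- The group `G̃'_red` has no nontrivial regular characters. -/
theorem character_Gs_eq_one (χ : CD.Gs.toGrp.Gp →* ℂˣ)
    (hχ : (fun x => (χ x : ℂ)) ∈ CD.Gs.toGrp.regAlg) (x : CD.Gs.toGrp.Gp) : χ x = 1 := by
  obtain ⟨K, hK⟩ := AffAlgGroup.exists_algSubgroup χ.ker fun y hy => by
    have h := hy _ (sub_mem hχ (one_mem _)) fun c hc => by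
      rw [MonoidHom.mem_ker] at hc
      simp [hc]
    exact Units.ext (sub_eq_zero.mp h)
  let ψ : K.toGrp.Gp →* G.Gp := CD.qG.toGpHom.comp (CD.Gs.incl.comp K.incl)
  have hψ : IsRegularMap K.toGrp.regAlg G.regAlg ψ :=
    (CD.qG.isRegularMap.comp (CD.Gs.isRegularMap_incl.comp K.isRegularMap_incl) :)
  obtain ⟨M, hM⟩ := AffAlgGroup.exists_algSubgroup ψ.range fun y hy =>
    mem_of_mem_closure_of_range_eq G.isAffineAlgebra_regAlg.fg G.separatesPts_regAlg
      G.isTranslationInvariant_regAlg K.toGrp.isAffineAlgebra_regAlg hψ rfl hy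
  have hLder := CD.Lder_min M fun l hl l' hl' => by
    obtain ⟨s, s', h⟩ := CD.exists_commutator_eq (l := ⟨l, LD.L.subset hl⟩)
      (l' := ⟨l', LD.L.subset hl'⟩) hl hl'
    have hker : s * (s' * (s⁻¹ * s'⁻¹)) ∈ χ.ker := by
      simp [MonoidHom.mem_ker]
    have hmem := (hM (CD.qG.toGpHom (CD.Gs.incl (s * (s' * (s⁻¹ * s'⁻¹)))))).mpr
      ⟨⟨_, (hK _).mpr hker⟩, rfl⟩
    rw [← h] at hmem
    exact hmem
  refine CD.Gs_connected.character_eq_one χ hχ (Nat.card_pos (α := CD.PiG)).ne' (fun y => ?_) x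
  obtain ⟨k, hk⟩ := (hM _).mp (hLder (CD.toGpHom_Gs_mem (s := CD.Gs.incl y) y.2))
  have hkχ : χ (K.incl k) = 1 := (hK (K.incl k)).mp k.2
  have hmem : CD.Gs.incl ((K.incl k)⁻¹ * y) ∈ CD.PiG := by
    change CD.qG.toGpHom _ = 1
    rw [map_mul, map_mul, map_inv, map_inv, ← hk]
    exact inv_mul_cancel _
  have hpow : ((K.incl k)⁻¹ * y) ^ Nat.card CD.PiG = 1 := by
    have h := congrArg (fun t : CD.PiG => t.1.1) (pow_card_eq_one' (x := (⟨_, hmem⟩ : CD.PiG)))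
    have h' : CD.Gs.incl (((K.incl k)⁻¹ * y) ^ Nat.card CD.PiG) = 1 := by
      rw [map_pow]
      exact Subtype.ext h
    exact Subtype.ext (congrArg (fun t : CD.Gt.Gp => t.1) h')
  have h := congrArg χ hpow
  rwa [map_pow, map_mul, map_inv, hkχ, inv_one, one_mul, map_one] at h

/-- A character of `Π_G` vanishing on `π₁(G'_red)` extends to a regular character of `G̃`. -/
theorem exists_character_extending (γ : CD.PiG →* ℂˣ)
    (hγ : ∀ x : CD.PiG, x.1 ∈ CD.Gs.toSubgroup → γ x = 1) :
    ∃ f : CD.Gt.Gp →* ℂˣ, (fun x => (f x : ℂ)) ∈ CD.Gt.regAlg ∧ ∀ x : CD.PiG, f x = γ x := by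
  have : CD.Gu'.toSubgroup.Normal := ⟨fun u hu g => by
    have h : g * (u * g⁻¹) ∈ CD.Gu'.toSubgroup := CD.Gu'_normal g.1 g.2 u.1 hu
    rwa [← mul_assoc] at h⟩
  obtain ⟨p, hp⟩ := exists_projection CD.Zc.incl CD.Zc_incl_injective CD.Gu'.toSubgroup
    CD.Gs.toSubgroup (fun z _ hs => CD.commute_Zc_Gs z hs)
    (fun z hz => Subtype.ext (CD.Zc_Gs_inter.subset ⟨z.2, hz⟩))
    (fun z s hs hu => Subtype.ext (CD.levi_inter.subset ⟨hu, z.1, z.2, s.1, hs, rfl⟩))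
    CD.exists_eq_mul
  let pPi : CD.PiG →* CD.Zc.toGrp.Gp := p.comp CD.PiG.subtype
  have hker : pPi.rangeRestrict.ker ≤ γ.ker := by
    intro x hx
    rw [MonoidHom.ker_rangeRestrict] at hx
    have hpx : p x.1 = 1 := hx
    refine hγ x ?_
    obtain ⟨u, hu, z, s, hs, h⟩ := CD.exists_eq_mul x.1
    have hqx : CD.qG.toGpHom x.1 = 1 := x.2
    have hu1 := CD.eq_one_of_toGpHom_mem hu z hs (by rw [← h, hqx]; exact one_mem _)
    rw [h, hp u hu z s hs] at hpx
    rw [h, hu1, hpx, map_one, one_mul, one_mul]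
    exact hs
  have : Finite pPi.range := Set.finite_range pPi
  let γ' : pPi.range →* ℂˣ :=
    pPi.rangeRestrict.liftOfSurjective pPi.rangeRestrict_surjective ⟨γ, hker⟩
  have hγ' : ∀ x, γ' (pPi.rangeRestrict x) = γ x := fun x =>
    MonoidHom.liftOfRightInverse_comp_apply _ _ _ ⟨γ, hker⟩ x
  obtain ⟨α, hα, hαγ⟩ := exists_regular_character_extending CD.mul_comm_Zc
    CD.Zc.toGrp.separatesPts_regAlg CD.Zc.toGrp.isTranslationInvariant_regAlg
    CD.Zc.toGrp.isRegularMap_mul pPi.range γ'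
  refine ⟨α.comp p, ?_, fun x => (hαγ (pPi.rangeRestrict x)).trans (hγ' x)⟩
  let B := boxAlgebra CD.Gu'.toGrp.regAlg (boxAlgebra CD.Zc.toGrp.regAlg CD.Gs.toGrp.regAlg)
  let π : CD.Gu'.toGrp.Gp × CD.Zc.toGrp.Gp × CD.Gs.toGrp.Gp → CD.Gt.Gp := fun w =>
    CD.Gu'.incl w.1 * (CD.Zc.incl w.2.1 * CD.Gs.incl w.2.2)
  have hB : IsAffineAlgebra B := CD.Gu'.toGrp.isAffineAlgebra_regAlg.box
    (CD.Zc.toGrp.isAffineAlgebra_regAlg.box CD.Gs.toGrp.isAffineAlgebra_regAlg)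
  have hfst := isRegularMap_fst CD.Gu'.toGrp.regAlg
    (boxAlgebra CD.Zc.toGrp.regAlg CD.Gs.toGrp.regAlg)
  have hsnd := isRegularMap_snd CD.Gu'.toGrp.regAlg
    (boxAlgebra CD.Zc.toGrp.regAlg CD.Gs.toGrp.regAlg)
  have hZ : IsRegularMap B CD.Zc.toGrp.regAlg (fun w => w.2.1) :=
    ((isRegularMap_fst CD.Zc.toGrp.regAlg CD.Gs.toGrp.regAlg).comp hsnd :)
  have hS : IsRegularMap B CD.Gs.toGrp.regAlg (fun w => w.2.2) :=
    ((isRegularMap_snd CD.Zc.toGrp.regAlg CD.Gs.toGrp.regAlg).comp hsnd :)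
  have hZS : IsRegularMap B CD.Gt.regAlg (fun w => CD.Zc.incl w.2.1 * CD.Gs.incl w.2.2) :=
    (CD.Gt.isRegularMap_mul.comp ((CD.Zc.isRegularMap_incl.comp hZ).prodMk
      (CD.Gs.isRegularMap_incl.comp hS)) :)
  have hπ : IsRegularMap B CD.Gt.regAlg π :=
    (CD.Gt.isRegularMap_mul.comp ((CD.Gu'.isRegularMap_incl.comp hfst).prodMk hZS) :)
  have hpπ : ∀ w, p (π w) = w.2.1 := fun w => hp _ w.1.2 _ _ w.2.2.2
  refine mem_of_surjective_of_comp_mem CD.Gt.isAffineAlgebra_regAlg CD.Gt.separatesPts_regAlg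
    CD.Gt.isTranslationInvariant_regAlg hB hπ (fun x => ?_) (α.comp p) ?_ ?_
  · obtain ⟨u, hu, z, s, hs, h⟩ := CD.exists_eq_mul x
    exact ⟨(⟨u.1, hu⟩, z, ⟨s.1, hs⟩), h.symm⟩
  · simp only [MonoidHom.comp_apply, hpπ]
    exact hZ.mem hα
  · simp only [MonoidHom.comp_apply, hpπ, ← map_inv]
    exact (CD.Zc.toGrp.isRegularMap_inv.comp hZ).mem hα

theorem exists_extension_iff {As : AffAlgGroup} (hAs : As.IsTorus) (γ : CD.PiG →* As.Gp) :
    (∃ d : AlgGroupHom CD.Gt As, ∀ x : CD.PiG, d.toFun x.1.1 = (γ x).1) ↔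
      ∀ x : CD.PiG, x.1.1 ∈ CD.Gs.carrier → γ x = 1 := by
  obtain ⟨k, Φ, hΦ, hΦ'⟩ := hAs.exists_mulEquiv
  constructor
  · rintro ⟨d, hd⟩ x hx
    have hdx : d.toGpHom x.1 = γ x := Subtype.ext (hd x)
    rw [← hdx]
    refine Φ.symm.injective ?_
    rw [map_one]
    funext j
    let χ : CD.Gs.toGrp.Gp →* ℂˣ := (Pi.evalMonoidHom (fun _ : Fin k => ℂˣ) j).comp
      (Φ.symm.toMonoidHom.comp (d.toGpHom.comp CD.Gs.incl))
    have hχ : (fun y => (χ y : ℂ)) ∈ CD.Gs.toGrp.regAlg :=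
      (d.isRegularMap.comp CD.Gs.isRegularMap_incl).mem (hΦ' j)
    exact CD.character_Gs_eq_one χ hχ ⟨x.1.1, hx⟩
  · intro hγ
    have hex : ∀ j, ∃ f : CD.Gt.Gp →* ℂˣ, (fun x => (f x : ℂ)) ∈ CD.Gt.regAlg ∧
        ∀ x : CD.PiG, f x = Φ.symm (γ x) j := fun j =>
      CD.exists_character_extending ((Pi.evalMonoidHom (fun _ : Fin k => ℂˣ) j).comp
        (Φ.symm.toMonoidHom.comp γ)) fun x hx => by simp [hγ x hx]
    choose f hf hfγ using hex
    obtain ⟨d, hd⟩ := exists_algGroupHom_of_isRegularMap (Φ.toMonoidHom.comp (MonoidHom.pi f))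
      (hΦ _ _ (fun x j => f j x) hf fun j => by
        simp only [← map_inv]
        exact CD.Gt.isRegularMap_inv.mem (hf j))
    refine ⟨d, fun x => (hd x.1).trans (congrArg Subtype.val ?_)⟩
    change Φ (fun j => f j x.1) = γ x
    rw [← Φ.eq_symm_apply]
    exact funext fun j => hfγ j x

end CoveringData

/-- A homomorphism `γ : Π_G → A_s` into a torus extends to a
morphism of algebraic groups `G̃ → A_s` if and only if it vanishes on the
subgroup `π₁(G'_red) ⊆ Π_G`; hence the image of the restriction map
`Hom(G̃, A_s) → Hom(Π_G, A_s)` is the annihilator of `π₁(G'_red)`. -/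
theorem character_of_kernel_extends_iff
    (G : AffAlgGroup) (hG : G.IsConnected) (LD : LeviDecomposition G)
    (CD : CoveringData G LD)
    (As : AffAlgGroup) (hAs : As.IsTorus)
    (γ : ↥CD.PiG →* As.Gp) :
    ((∃ d : AlgGroupHom CD.Gt As, ∀ x : ↥CD.PiG, d.toFun x.1.1 = (γ x).1) ↔
      ∀ x : ↥CD.PiG, x.1.1 ∈ CD.Gs.carrier → γ x = 1) ∧
    {γ' : ↥CD.PiG →* As.Gp |
        ∃ d : AlgGroupHom CD.Gt As, ∀ x : ↥CD.PiG, d.toFun x.1.1 = (γ' x).1} =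
      {γ' : ↥CD.PiG →* As.Gp | ∀ x : ↥CD.PiG, x.1.1 ∈ CD.Gs.carrier → γ' x = 1} := by
  exact ⟨CD.exists_extension_iff hAs γ, Set.ext fun γ' => CD.exists_extension_iff hAs γ'⟩
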